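/- arXiv:2208.09760 — 8 statements merged into one kernel-verified Lean document; each statement's English description precedes it below -/
import Mathlib

section
/- Let n be a positive integer, let τ be a truncated addition table over n elements, and let f be a positive integer. Then the map (x_1, …, x_n) ↦ {0} ∪ {x_1, …, x_n} ∪ {m ∈ ℕ : m ≥ f+1} is a bijection between the integer lattice points of the dilate f·P_τ of the SR-polytope of τ and the set of numerical semigroups with Frobenius number f having exactly n positive sporadic elements whose sporadic addition table is τ. -/
open Pointwise

/-- A numerical semigroup: a subset of ℕ containing 0, closed under addition,
with finite complement. -/
def IsNumericalSemigroup (S : Set ℕ) : Prop :=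
  0 ∈ S ∧ (∀ a ∈ S, ∀ b ∈ S, a + b ∈ S) ∧ Sᶜ.Finite

/-- `f` is the Frobenius number of `S`: the largest gap. -/
def IsFrobenius (S : Set ℕ) (f : ℕ) : Prop :=
  f ∉ S ∧ ∀ m, m ∉ S → m ≤ f

/-- The SR-polytope of a truncated addition table `τ` over `n` elements
(`τ i j = none` encodes the value ∞). -/
def SRPolytope (n : ℕ) (τ : Fin n → Fin n → Option (Fin n)) : Set (Fin n → ℝ) :=
  {x | (∀ i, 0 < x i ∧ x i < 1) ∧ (∀ i j : Fin n, i < j → x i < x j) ∧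
    (∀ i j k, τ i j = some k → x i + x j = x k) ∧
    (∀ i j, τ i j = none → 1 < x i + x j)}

/-- `S` has exactly `n` positive sporadic elements (w.r.t. Frobenius number `f`) and its
sporadic addition table is `τ`. -/
def HasSporadicTable (S : Set ℕ) (f n : ℕ) (τ : Fin n → Fin n → Option (Fin n)) : Prop :=
  ∃ x : Fin n → ℕ, StrictMono x ∧ (∀ i, x i ∈ S ∧ 0 < x i ∧ x i < f) ∧
    (∀ s ∈ S, 0 < s → s < f → ∃ i, x i = s) ∧
    (∀ i j k, τ i j = some k ↔ x i + x j = x k) ∧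
    (∀ i j, τ i j = none ↔ f < x i + x j)

/-- Integer points of the dilate `f • P_τ`, described by conditions over `ℤ`. -/
lemma intCast_mem_smul_SRPolytope_iff {n f : ℕ} (hf : 0 < f)
    {τ : Fin n → Fin n → Option (Fin n)} {x : Fin n → ℤ} :
    (fun i => (x i : ℝ)) ∈ (f : ℝ) • SRPolytope n τ ↔
      (∀ i, 0 < x i ∧ x i < f) ∧ StrictMono x ∧
      (∀ i j k, τ i j = some k → x i + x j = x k) ∧
      (∀ i j, τ i j = none → (f : ℤ) < x i + x j) := by
  have hf' : (0 : ℝ) < f := by exact_mod_cast hf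
  have hinv : (0 : ℝ) < (f : ℝ)⁻¹ := inv_pos.2 hf'
  rw [Set.mem_smul_set_iff_inv_smul_mem₀ hf'.ne']
  simp only [SRPolytope, Set.mem_ofPred_eq, Pi.smul_apply, smul_eq_mul, ← mul_add,
    mul_right_inj' hinv.ne', mul_lt_mul_iff_right₀ hinv, mul_pos_iff_of_pos_left hinv,
    inv_mul_lt_one₀ hf', one_lt_inv_mul₀ hf', StrictMono]
  norm_cast

/-- The set attached to a vector satisfying the relations prescribed by `τ` is a numerical
semigroup. -/
lemma isNumericalSemigroup_of_lattice_point {n f : ℕ}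
    {τ : Fin n → Fin n → Option (Fin n)} {x : Fin n → ℤ}
    (hsome : ∀ i j k, τ i j = some k → x i + x j = x k)
    (hnone : ∀ i j, τ i j = none → (f : ℤ) < x i + x j) :
    IsNumericalSemigroup
      ({0} ∪ {m : ℕ | ∃ i, x i = (m : ℤ)} ∪ {m : ℕ | f + 1 ≤ m} : Set ℕ) := by
  refine ⟨by simp, ?_, (Set.finite_Iic f).subset fun m hm => ?_⟩
  · rintro a ((rfl | ⟨i, hi⟩) | ha) b ((rfl | ⟨j, hj⟩) | hb)
    · simp
    · exact Or.inl (Or.inr ⟨j, by simpa using hj⟩)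
    · exact Or.inr (by simpa using hb)
    · exact Or.inl (Or.inr ⟨i, by simpa using hi⟩)
    · cases h : τ i j with
      | none =>
        have := hnone i j h
        exact Or.inr (by simp only [Set.mem_ofPred_eq]; omega)
      | some k =>
        have := hsome i j k h
        exact Or.inl (Or.inr ⟨k, by push_cast; omega⟩)
    all_goals
      simp only [Set.mem_ofPred_eq] at *
      exact Or.inr (by simp only [Set.mem_ofPred_eq]; omega)
  · by_contra h
    simp only [Set.mem_Iic, not_le] at h
    exact hm (Or.inr h)

/-- The map sending a lattice point of the dilate `f • P_τ` to
`{0} ∪ {x₁, …, xₙ} ∪ {m : m ≥ f+1}` is a bijection onto the set of numerical semigroups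
with Frobenius number `f` and sporadic addition table `τ`. -/
theorem sr_polytope_lattice_points_biject_numerical_semigroups
    (n f : ℕ) (hn : 0 < n) (hf : 0 < f) (τ : Fin n → Fin n → Option (Fin n)):
    Set.BijOn
      (fun x : Fin n → ℤ =>
        ({0} ∪ {m : ℕ | ∃ i, x i = (m : ℤ)} ∪ {m : ℕ | f + 1 ≤ m} : Set ℕ))
      {x : Fin n → ℤ | (fun i => (x i : ℝ)) ∈ (f : ℝ) • SRPolytope n τ}
      {S : Set ℕ | IsNumericalSemigroup S ∧ IsFrobenius S f ∧ HasSporadicTable S f n τ} := by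
  constructor
  · intro x hx
    obtain ⟨hb, hmono, hsome, hnone⟩ := (intCast_mem_smul_SRPolytope_iff hf).1 hx
    refine ⟨isNumericalSemigroup_of_lattice_point hsome hnone, ⟨?_, ?_⟩, ?_⟩
    · rintro ((h | ⟨i, hi⟩) | h)
      · exact hf.ne' h
      · have := hb i
        omega
      · simp at h
    · intro m hm
      by_contra! h
      exact hm (Or.inr h)
    · have hcast : ∀ i, ((x i).toNat : ℤ) = x i := fun i => Int.toNat_of_nonneg (hb i).1.le
      refine ⟨fun i => (x i).toNat, fun i j hij => ?_,
        fun i => ⟨Or.inl (Or.inr ⟨i, (hcast i).symm⟩), ?_, ?_⟩, ?_, fun i j k => ⟨fun h => ?_,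
        fun h => ?_⟩, fun i j => ⟨fun h => ?_, fun h => ?_⟩⟩
      all_goals beta_reduce at *
      · have := hmono hij
        have := hcast i
        have := hcast j
        omega
      · have := hb i
        omega
      · have := hb i
        omega
      · rintro s ((rfl | ⟨i, hi⟩) | h) h0 hsf
        · exact absurd h0 (lt_irrefl 0)
        · exact ⟨i, by simp [hi]⟩
        · simp only [Set.mem_ofPred_eq] at h
          omega
      · have := hsome i j k h
        have := hb i
        have := hb j
        omega
      · have := hb i
        have := hb j
        have := hb k
        cases h' : τ i j with
        | none =>
          have := hnone i j h'
          omega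
        | some l =>
          have := hsome i j l h'
          rw [hmono.injective (show x l = x k by omega)]
      · have := hnone i j h
        omega
      · cases h' : τ i j with
        | none => rfl
        | some l =>
          have := hsome i j l h'
          have := hb i
          have := hb j
          have := hb l
          omega
  constructor
  · intro x hx y hy hxy
    obtain ⟨hxb, hxm, -, -⟩ := (intCast_mem_smul_SRPolytope_iff hf).1 hx
    obtain ⟨hyb, hym, -, -⟩ := (intCast_mem_smul_SRPolytope_iff hf).1 hy
    have range_subset : ∀ {u v : Fin n → ℤ}, (∀ i, 0 < u i ∧ u i < f) →
        ({0} ∪ {m : ℕ | ∃ i, u i = (m : ℤ)} ∪ {m : ℕ | f + 1 ≤ m} : Set ℕ) =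
          {0} ∪ {m : ℕ | ∃ i, v i = (m : ℤ)} ∪ {m : ℕ | f + 1 ≤ m} →
        Set.range u ⊆ Set.range v := by
      rintro u v hu huv _ ⟨i, rfl⟩
      have := hu i
      have hcast : ((u i).toNat : ℤ) = u i := Int.toNat_of_nonneg this.1.le
      have hmem : (u i).toNat ∈
          ({0} ∪ {m : ℕ | ∃ i, u i = (m : ℤ)} ∪ {m : ℕ | f + 1 ≤ m} : Set ℕ) :=
        Or.inl (Or.inr ⟨i, hcast.symm⟩)
      rw [huv] at hmem
      rcases hmem with (h | ⟨j, hj⟩) | h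
      · simp only [Set.mem_singleton_iff] at h
        omega
      · exact ⟨j, hj.trans hcast⟩
      · simp only [Set.mem_ofPred_eq] at h
        omega
    exact (hxm.range_inj hym).1
      ((range_subset hxb hxy).antisymm (range_subset hyb hxy.symm))
  · rintro S ⟨⟨h0, -, -⟩, ⟨hfS, hmax⟩, x, hmono, hb, hall, hsome, hnone⟩
    refine ⟨fun i => (x i : ℤ), (intCast_mem_smul_SRPolytope_iff hf).2 ⟨fun i => ?_,
      fun i j hij => ?_, fun i j k h => ?_, fun i j h => ?_⟩, ?_⟩
    · exact_mod_cast (hb i).2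
    · exact Int.ofNat_lt.2 (hmono hij)
    · exact_mod_cast (hsome i j k).1 h
    · exact_mod_cast (hnone i j).1 h
    · ext m
      constructor
      · rintro ((rfl | ⟨i, hi⟩) | h)
        · exact h0
        · rw [← Int.ofNat_inj.1 hi]
          exact (hb i).1
        · by_contra hm
          exact absurd (hmax m hm) (not_le.2 h)
      · intro hm
        rcases Nat.eq_zero_or_pos m with rfl | hpos
        · exact Or.inl (Or.inl rfl)
        rcases lt_trichotomy m f with hlt | rfl | hgt
        · obtain ⟨i, hi⟩ := hall m hm hpos hlt
          exact Or.inl (Or.inr ⟨i, by simp [hi]⟩)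
        · exact absurd hm hfS
        · exact Or.inr hgt
end

section
/- Fix a positive integer n, and for each positive integer f let N(n,f) denote the number of numerical semigroups with Frobenius number f having exactly n positive sporadic elements (equivalently, n+1 sporadic elements including 0). Then N(n,f) is a quasi-polynomial function of f of degree n, and every one of its constituent polynomials has leading coefficient 1/(2^n · n!). -/
/-- The number of numerical semigroups with Frobenius number `f` and exactly `n`
positive sporadic elements. -/
noncomputable def NumSgpCount (n f : ℕ) : ℕ :=
  {S : Set ℕ | IsNumericalSemigroup S ∧ IsFrobenius S f ∧
    {s ∈ S | 0 < s ∧ s < f}.ncard = n}.ncard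

/-- The generators of the algebra of quasi-polynomials on `ℤ`. -/
inductive IsQuasiPolyGenerator : (ℤ → ℚ) → Prop
  | cast : IsQuasiPolyGenerator fun m => (m : ℚ)
  | periodic (h : ℤ → ℚ) (K : ℕ) (hK : 0 < K) (hper : Function.Periodic h (K : ℤ)) :
      IsQuasiPolyGenerator h

/-- The algebra of quasi-polynomials on `ℤ`. -/
def quasiPoly : Subalgebra ℚ (ℤ → ℚ) := Algebra.adjoin ℚ {g | IsQuasiPolyGenerator g}

/-- The generators of the algebra of piecewise quasi-polynomials: linear forms, periodic functions
of linear forms, and indicators of open half-spaces through the origin. -/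
inductive IsPiecewiseGenerator {V : Type} [AddCommGroup V] : (V → ℚ) → Prop
  | linear (l : V →+ ℤ) : IsPiecewiseGenerator fun x => (l x : ℚ)
  | periodic (l : V →+ ℤ) (h : ℤ → ℚ) (K : ℕ) (hK : 0 < K) (hper : Function.Periodic h (K : ℤ)) :
      IsPiecewiseGenerator fun x => h (l x)
  | pos (l : V →+ ℤ) : IsPiecewiseGenerator fun x => if 0 < l x then 1 else 0

/-- The algebra of piecewise quasi-polynomial functions on `V`, where the pieces are
relatively open polyhedral cones. -/
def piecewiseQuasiPoly (V : Type) [AddCommGroup V] : Subalgebra ℚ (V → ℚ) :=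
  Algebra.adjoin ℚ {g | IsPiecewiseGenerator g}

section QuasiPoly

lemma cast_mem_quasiPoly : (fun m : ℤ => (m : ℚ)) ∈ quasiPoly :=
  Algebra.subset_adjoin .cast

lemma periodic_mem_quasiPoly {h : ℤ → ℚ} {K : ℕ} (hK : 0 < K)
    (hper : Function.Periodic h (K : ℤ)) : h ∈ quasiPoly :=
  Algebra.subset_adjoin (.periodic h K hK hper)

lemma const_mem_quasiPoly (c : ℚ) : (fun _ : ℤ => c) ∈ quasiPoly :=
  quasiPoly.algebraMap_mem c

lemma periodic_emod (b : ℤ) (K : ℕ) (φ : ℤ → ℚ) :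
    Function.Periodic (fun m : ℤ => φ ((m - b) % K)) (K : ℤ) := by
  intro m
  have : m + K - b = m - b + K := by ring
  simp [this]

lemma cast_sub_ediv (m b : ℤ) {K : ℕ} (hK : 0 < K) :
    (((m - b) / (K : ℤ) : ℤ) : ℚ) = ((m : ℚ) - b - ((m - b) % K : ℤ)) / K := by
  have h := Int.mul_ediv_add_emod (m - b) K
  have hK' : (K : ℚ) ≠ 0 := by positivity
  rw [eq_div_iff hK']
  have h2 : (m : ℚ) - b = ((m - b : ℤ) : ℚ) := by push_cast; ring
  rw [h2]
  nth_rewrite 2 [← h]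
  push_cast
  ring

lemma ediv_mem_quasiPoly (b : ℤ) {K : ℕ} (hK : 0 < K) :
    (fun m : ℤ => (((m - b) / (K : ℤ) : ℤ) : ℚ)) ∈ quasiPoly := by
  have h : (fun m : ℤ => (((m - b) / (K : ℤ) : ℤ) : ℚ)) =
      ((fun m : ℤ => (m : ℚ)) - (fun _ => (b : ℚ)) - fun m : ℤ => (((m - b) % K : ℤ) : ℚ)) *
        fun _ => (K : ℚ)⁻¹ := by
    funext m
    simp [cast_sub_ediv m b hK, div_eq_mul_inv]
  rw [h]
  exact mul_mem (sub_mem (sub_mem cast_mem_quasiPoly (const_mem_quasiPoly _))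
    (periodic_mem_quasiPoly hK (periodic_emod b K fun z => (z : ℚ)))) (const_mem_quasiPoly _)

lemma eval_mem_quasiPoly {g : ℤ → ℚ} (hg : g ∈ quasiPoly) (P : Polynomial ℚ) :
    (fun m => P.eval (g m)) ∈ quasiPoly := by
  induction P using Polynomial.induction_on' with
  | add p q hp hq =>
    simp only [Polynomial.eval_add]
    exact add_mem hp hq
  | monomial n a =>
    simp only [Polynomial.eval_monomial]
    exact mul_mem (const_mem_quasiPoly a) (pow_mem hg n)

lemma periodic_eq_sum {h : ℤ → ℚ} {K : ℕ} (hK : 0 < K) (hper : Function.Periodic h (K : ℤ))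
    (m : ℤ) : h m = ∑ s ∈ Finset.range K, if m % K = s then h s else 0 := by
  have hK' : (0 : ℤ) < K := by exact_mod_cast hK
  have h0 := Int.emod_nonneg m hK'.ne'
  have h1 := Int.emod_lt_of_pos m hK'
  rw [Finset.sum_eq_single (m % K).toNat]
  · rw [Int.toNat_of_nonneg h0, if_pos rfl]
    nth_rewrite 1 [← Int.emod_add_mul_ediv m K, mul_comm]
    exact (hper.int_mul _) _
  · intro b _ hb
    rw [if_neg]
    omega
  · intro hb
    simp at hb
    omega

/-- Every function `m ↦ m ^ k * h m` with `h` periodic has a quasi-polynomial antidifference. -/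
lemma exists_antidifference (k : ℕ) {h : ℤ → ℚ} {K : ℕ} (hK : 0 < K)
    (hper : Function.Periodic h (K : ℤ)) :
    ∃ F ∈ quasiPoly, ∀ m : ℤ, F m - F (m - 1) = (m : ℚ) ^ k * h m := by
  have hK' : (0 : ℤ) < K := by exact_mod_cast hK
  have hKq : (K : ℚ) ≠ 0 := by positivity
  let G : ℕ → ℤ → ℚ := fun s m =>
    (h s * K ^ k / (k + 1)) * (Polynomial.bernoulli (k + 1)).eval
      (1 + ((((m - s) / (K : ℤ) : ℤ) : ℚ) + s / K))
  refine ⟨∑ s ∈ Finset.range K, G s, sum_mem fun s _ => ?_, fun m => ?_⟩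
  · exact mul_mem (const_mem_quasiPoly _) (eval_mem_quasiPoly
      (add_mem (const_mem_quasiPoly 1)
        (add_mem (ediv_mem_quasiPoly (s : ℤ) hK) (const_mem_quasiPoly _))) _)
  · rw [periodic_eq_sum hK hper m, Finset.mul_sum, Finset.sum_apply, Finset.sum_apply,
      ← Finset.sum_sub_distrib]
    refine Finset.sum_congr rfl fun s hs => ?_
    have hsK := Finset.mem_range.1 hs
    simp only [G]
    rw [← mul_sub]
    split_ifs with hm
    · obtain ⟨q, hq⟩ : ∃ q : ℤ, m = s + K * q :=
        ⟨m / K, by rw [← hm]; exact (Int.emod_add_mul_ediv m K).symm⟩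
      have e1 : (m - s) / (K : ℤ) = q := by
        rw [hq, add_sub_cancel_left, Int.mul_ediv_cancel_left _ hK'.ne']
      have e2 : (m - 1 - s) / (K : ℤ) = q - 1 := by
        rw [hq, Int.ediv_eq_iff_of_pos hK']
        constructor <;> nlinarith
      rw [e1, e2, Polynomial.bernoulli_eval_one_add]
      have e3 : (1 : ℚ) + (((q - 1 : ℤ) : ℚ) + s / K) = q + s / K := by push_cast; ring
      rw [e3, hq]
      push_cast
      have e4 : (s : ℚ) + K * q = K * (q + s / K) := by field_simp; ring
      rw [e4, mul_pow]
      have : (k : ℚ) + 1 ≠ 0 := by positivity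
      field_simp
      ring
    · have e : (m - 1 - s) / (K : ℤ) = (m - s) / (K : ℤ) := by
        have h1 := Int.mul_ediv_add_emod (m - s) K
        have h2 := Int.emod_nonneg (m - s) hK'.ne'
        have h3 := Int.emod_lt_of_pos (m - s) hK'
        have h4 : (m - s) % K ≠ 0 := by
          intro h4
          apply hm
          rw [Int.emod_eq_emod_iff_emod_sub_eq_zero.2 h4]
          exact Int.emod_eq_of_lt (by positivity) (by exact_mod_cast hsK)
        rw [Int.ediv_eq_iff_of_pos hK']
        constructor <;> nlinarith [lt_of_le_of_ne h2 h4.symm]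
      rw [e]
      simp

lemma sum_Ioo_of_antidifference {F u : ℤ → ℚ} (hF : ∀ m, F m - F (m - 1) = u m) {a b : ℤ}
    (hab : a < b) : ∑ y ∈ Finset.Ioo a b, u y = F (b - 1) - F a := by
  have hab' : a + 1 ≤ b := hab
  induction b, hab' using Int.leInduction with
  | base =>
    have : Finset.Ioo a (a + 1) = ∅ := by
      ext z; simp
    simp [this]
  | succ b hb ih =>
    have : Finset.Ioo a (b + 1) = insert b (Finset.Ioo a b) := by
      ext z; simp; omega
    rw [this, Finset.sum_insert (by simp), ih hb, ← hF b]
    simp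

end QuasiPoly

section Piecewise

variable {V W : Type} [AddCommGroup V] [AddCommGroup W]

lemma linear_mem_piecewise (l : V →+ ℤ) : (fun x => (l x : ℚ)) ∈ piecewiseQuasiPoly V :=
  Algebra.subset_adjoin (.linear l)

lemma pos_mem_piecewise (l : V →+ ℤ) :
    (fun x => if 0 < l x then (1 : ℚ) else 0) ∈ piecewiseQuasiPoly V :=
  Algebra.subset_adjoin (.pos l)

lemma periodic_mem_piecewise (l : V →+ ℤ) {h : ℤ → ℚ} {K : ℕ} (hK : 0 < K)
    (hper : Function.Periodic h (K : ℤ)) : (fun x => h (l x)) ∈ piecewiseQuasiPoly V :=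
  Algebra.subset_adjoin (.periodic l h K hK hper)

lemma const_mem_piecewise (c : ℚ) : (fun _ : V => c) ∈ piecewiseQuasiPoly V :=
  (piecewiseQuasiPoly V).algebraMap_mem c

lemma comp_mem_piecewise (ψ : W →+ V) {g : V → ℚ} (hg : g ∈ piecewiseQuasiPoly V) :
    (fun x => g (ψ x)) ∈ piecewiseQuasiPoly W := by
  induction hg using Algebra.adjoin_induction with
  | mem g hg =>
    cases hg with
    | linear l => exact linear_mem_piecewise (l.comp ψ)
    | periodic l h K hK hper => exact periodic_mem_piecewise (l.comp ψ) hK hper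
    | pos l => exact pos_mem_piecewise (l.comp ψ)
  | algebraMap r => exact const_mem_piecewise r
  | add _ _ _ _ hx hy => exact add_mem hx hy
  | mul _ _ _ _ hx hy => exact mul_mem hx hy

lemma quasiPoly_ediv_mem_piecewise {q : ℤ → ℚ} (hq : q ∈ quasiPoly) (l : V →+ ℤ) (b : ℤ) {c : ℕ}
    (hc : 0 < c) : (fun x => q ((l x - b) / (c : ℤ))) ∈ piecewiseQuasiPoly V := by
  have hc' : (c : ℤ) ≠ 0 := by exact_mod_cast hc.ne'
  induction hq using Algebra.adjoin_induction with
  | mem g hg =>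
    cases hg with
    | cast =>
      have h : (fun x => (((l x - b) / (c : ℤ) : ℤ) : ℚ)) =
          ((fun x => (l x : ℚ)) - (fun _ => (b : ℚ)) -
            fun x => (((l x - b) % c : ℤ) : ℚ)) * fun _ => (c : ℚ)⁻¹ := by
        funext x
        simp [cast_sub_ediv (l x) b hc, div_eq_mul_inv]
      rw [h]
      exact mul_mem (sub_mem (sub_mem (linear_mem_piecewise l) (const_mem_piecewise _))
        (periodic_mem_piecewise l hc (periodic_emod b c fun z => (z : ℚ)))) (const_mem_piecewise _)
    | periodic _ K hK hper =>
      refine periodic_mem_piecewise l (h := fun m => g ((m - b) / (c : ℤ))) (K := c * K)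
        (by positivity) fun m => ?_
      have e : m + ((c * K : ℕ) : ℤ) - b = m - b + (c : ℤ) * K := by push_cast; ring
      simp only [e]
      rw [Int.add_mul_ediv_left _ _ hc', hper]
  | algebraMap r => exact const_mem_piecewise r
  | add _ _ _ _ hx hy => exact add_mem hx hy
  | mul _ _ _ _ hx hy => exact mul_mem hx hy

end Piecewise

section PiecewiseSets

variable {V : Type} [AddCommGroup V]

/-- A set whose indicator function is a piecewise quasi-polynomial. -/
def IsPiecewiseSet (s : Set V) : Prop := s.indicator (1 : V → ℚ) ∈ piecewiseQuasiPoly V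

lemma isPiecewiseSet_pos (l : V →+ ℤ) : IsPiecewiseSet {x | 0 < l x} := by
  have h := pos_mem_piecewise l
  have e : (fun x => if 0 < l x then (1 : ℚ) else 0) = {x | 0 < l x}.indicator 1 := by
    funext x
    rw [Set.indicator_apply]
    rfl
  rwa [e] at h

lemma IsPiecewiseSet.compl {s : Set V} (hs : IsPiecewiseSet s) : IsPiecewiseSet sᶜ := by
  unfold IsPiecewiseSet
  rw [Set.indicator_compl]
  exact sub_mem (one_mem _) hs

lemma IsPiecewiseSet.inter {s t : Set V} (hs : IsPiecewiseSet s) (ht : IsPiecewiseSet t) :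
    IsPiecewiseSet (s ∩ t) := by
  unfold IsPiecewiseSet
  rw [Set.inter_indicator_one]
  exact mul_mem hs ht

lemma IsPiecewiseSet.union {s t : Set V} (hs : IsPiecewiseSet s) (ht : IsPiecewiseSet t) :
    IsPiecewiseSet (s ∪ t) := by
  have := (hs.compl.inter ht.compl).compl
  rwa [Set.compl_inter, compl_compl, compl_compl] at this

lemma IsPiecewiseSet.iInter {ι : Type} [Finite ι] {s : ι → Set V}
    (hs : ∀ i, IsPiecewiseSet (s i)) : IsPiecewiseSet (⋂ i, s i) := by
  classical
  have := Fintype.ofFinite ι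
  have key : ∀ t : Finset ι, IsPiecewiseSet (⋂ i ∈ t, s i) := by
    intro t
    induction t using Finset.induction_on with
    | empty =>
      simp only [Finset.notMem_empty, Set.iInter_of_empty, Set.iInter_univ, IsPiecewiseSet,
        Set.indicator_univ]
      exact one_mem _
    | insert i t _ ih =>
      rw [Finset.set_biInter_insert]
      exact (hs i).inter ih
  simpa using key Finset.univ

lemma IsPiecewiseSet.iUnion {ι : Type} [Finite ι] {s : ι → Set V}
    (hs : ∀ i, IsPiecewiseSet (s i)) : IsPiecewiseSet (⋃ i, s i) := by
  have := (IsPiecewiseSet.iInter fun i => (hs i).compl).compl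
  simpa [Set.compl_iInter] using this

lemma isPiecewiseSet_lt (l₁ l₂ : V →+ ℤ) : IsPiecewiseSet {x | l₁ x < l₂ x} := by
  simpa using isPiecewiseSet_pos (l₂ - l₁)

lemma isPiecewiseSet_le (l₁ l₂ : V →+ ℤ) : IsPiecewiseSet {x | l₁ x ≤ l₂ x} := by
  simpa [Set.compl_def] using (isPiecewiseSet_lt l₂ l₁).compl

lemma isPiecewiseSet_eq (l₁ l₂ : V →+ ℤ) : IsPiecewiseSet {x | l₁ x = l₂ x} := by
  have := (isPiecewiseSet_le l₁ l₂).inter (isPiecewiseSet_le l₂ l₁)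
  rwa [← Set.ofPred_and, show (fun x => l₁ x ≤ l₂ x ∧ l₂ x ≤ l₁ x) = fun x => l₁ x = l₂ x from
    funext fun x => propext le_antisymm_iff.symm] at this

lemma isPiecewiseSet_lt_add (l₁ l₂ : V →+ ℤ) {b : ℤ} (hb : b = 0 ∨ b = 1) :
    IsPiecewiseSet {x | l₁ x < l₂ x + b} := by
  rcases hb with rfl | rfl
  · simpa using isPiecewiseSet_lt l₁ l₂
  · simpa [Int.lt_add_one_iff] using isPiecewiseSet_le l₁ l₂

lemma IsPiecewiseSet.ite_mem {p : V → Prop} [DecidablePred p] (hp : IsPiecewiseSet {x | p x})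
    {g : V → ℚ} (hg : g ∈ piecewiseQuasiPoly V) :
    (fun x => if p x then g x else 0) ∈ piecewiseQuasiPoly V := by
  have e : (fun x => if p x then g x else 0) = {x | p x}.indicator 1 * g := by
    funext x
    by_cases h : p x <;> simp [h]
  rw [e]
  exact mul_mem hp hg

end PiecewiseSets

section Elimination

variable {V : Type} [AddCommGroup V]

/-- The functions `(x, y) ↦ a x * y ^ k * h y` restricted to a half-line `l x < c * y + b` in the
last variable; with `b ∈ {0, 1}` this covers both strict and non-strict lower bounds. -/
inductive IsCutTerm : (V × ℤ → ℚ) → Prop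
  | mk (a : V → ℚ) (ha : a ∈ piecewiseQuasiPoly V) (k : ℕ) (h : ℤ → ℚ) (K : ℕ) (hK : 0 < K)
      (hper : Function.Periodic h (K : ℤ)) (l : V →+ ℤ) (c : ℕ) (hc : 0 < c) (b : ℤ)
      (hb : b = 0 ∨ b = 1) :
      IsCutTerm fun z => a z.1 * ((z.2 : ℚ) ^ k * h z.2) * if l z.1 < c * z.2 + b then 1 else 0

/-- The span of the cut terms. -/
def cutSpan (V : Type) [AddCommGroup V] : Submodule ℚ (V × ℤ → ℚ) :=
  Submodule.span ℚ {g | IsCutTerm g}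

lemma IsCutTerm.coeff_mul {g : V × ℤ → ℚ} (hg : IsCutTerm g) {a : V → ℚ}
    (ha : a ∈ piecewiseQuasiPoly V) : IsCutTerm fun z => a z.1 * g z := by
  cases hg with
  | mk a' ha' k h K hK hper l c hc b hb =>
    convert IsCutTerm.mk (a * a') (mul_mem ha ha') k h K hK hper l c hc b hb using 2 with z
    simp only [Pi.mul_apply]
    ring

lemma IsCutTerm.var_mul {g : V × ℤ → ℚ} (hg : IsCutTerm g) : IsCutTerm fun z => z.2 * g z := by
  cases hg with
  | mk a ha k h K hK hper l c hc b hb =>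
    convert IsCutTerm.mk a ha (k + 1) h K hK hper l c hc b hb using 2 with z
    ring

lemma IsCutTerm.periodic_mul {g : V × ℤ → ℚ} (hg : IsCutTerm g) {h : ℤ → ℚ} {K : ℕ} (hK : 0 < K)
    (hper : Function.Periodic h (K : ℤ)) : IsCutTerm fun z => h z.2 * g z := by
  cases hg with
  | mk a ha k h' K' hK' hper' l c hc b hb =>
    have hper'' : Function.Periodic (h * h') ((K * K' : ℕ) : ℤ) := by
      push_cast
      have h1 := hper.int_mul (K' : ℤ)
      have h2 := hper'.int_mul (K : ℤ)
      rw [mul_comm] at h1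
      exact h1.mul h2
    convert IsCutTerm.mk a ha k (h * h') (K * K') (by positivity) hper'' l c hc b hb using 2 with z
    simp only [Pi.mul_apply]
    ring

lemma ite_cut_mul_ite_cut {l₁ l₂ y b₁ b₂ : ℤ} {c₁ c₂ : ℕ} (h₁ : 0 < c₁) (h₂ : 0 < c₂)
    (hb₁ : b₁ = 0 ∨ b₁ = 1) (hb₂ : b₂ = 0 ∨ b₂ = 1) (hb : b₁ ≤ b₂) :
    ((if l₁ < c₁ * y + b₁ then 1 else 0) * (if l₂ < c₂ * y + b₂ then 1 else 0) : ℚ) =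
      (if c₁ * l₂ ≤ c₂ * l₁ then 1 else 0) * (if l₁ < c₁ * y + b₁ then 1 else 0) +
      (if c₂ * l₁ < c₁ * l₂ then 1 else 0) * (if l₂ < c₂ * y + b₂ then 1 else 0) := by
  have h₁' : (0 : ℤ) < c₁ := by exact_mod_cast h₁
  have h₂' : (0 : ℤ) < c₂ := by exact_mod_cast h₂
  by_cases hA : (c₁ : ℤ) * l₂ ≤ c₂ * l₁
  · have hA' : ¬ (c₂ : ℤ) * l₁ < c₁ * l₂ := not_lt.2 hA
    by_cases ht : l₁ < c₁ * y + b₁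
    · have : l₂ < c₂ * y + b₂ := by
        by_contra hcon
        rcases hb₁ with rfl | rfl <;> rcases hb₂ with rfl | rfl <;> first | omega | nlinarith
      simp [hA, hA', ht, this]
    · simp [hA', ht]
  · have hA' : (c₂ : ℤ) * l₁ < c₁ * l₂ := not_le.1 hA
    by_cases ht : l₂ < c₂ * y + b₂
    · have : l₁ < c₁ * y + b₁ := by
        by_contra hcon
        rcases hb₁ with rfl | rfl <;> rcases hb₂ with rfl | rfl <;> first | omega | nlinarith
      simp [hA, hA', ht, this]
    · simp [hA, ht]

lemma IsCutTerm.cut_mul {g : V × ℤ → ℚ} (hg : IsCutTerm g) (l : V →+ ℤ) {c : ℕ} (hc : 0 < c)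
    {b : ℤ} (hb : b = 0 ∨ b = 1) :
    (fun z : V × ℤ => (if l z.1 < c * z.2 + b then 1 else 0) * g z) ∈ cutSpan V := by
  cases hg with
  | mk a ha k h K hK hper l' c' hc' b' hb' =>
    have key : ∀ (l₁ l₂ : V →+ ℤ) (c₁ c₂ : ℕ) (b₁ b₂ : ℤ), 0 < c₁ → 0 < c₂ →
        (b₁ = 0 ∨ b₁ = 1) → (b₂ = 0 ∨ b₂ = 1) → b₁ ≤ b₂ →
        (fun z : V × ℤ => a z.1 * ((z.2 : ℚ) ^ k * h z.2) *
          ((if l₁ z.1 < c₁ * z.2 + b₁ then 1 else 0) *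
            (if l₂ z.1 < c₂ * z.2 + b₂ then 1 else 0))) ∈ cutSpan V := by
      intro l₁ l₂ c₁ c₂ b₁ b₂ h₁ h₂ hb₁ hb₂ hle
      have e : (fun z : V × ℤ => a z.1 * ((z.2 : ℚ) ^ k * h z.2) *
          ((if l₁ z.1 < c₁ * z.2 + b₁ then 1 else 0) *
            (if l₂ z.1 < c₂ * z.2 + b₂ then 1 else 0))) =
          (fun z : V × ℤ => (if c₁ * l₂ z.1 ≤ c₂ * l₁ z.1 then a z.1 else 0) *
            ((z.2 : ℚ) ^ k * h z.2) * (if l₁ z.1 < c₁ * z.2 + b₁ then 1 else 0)) +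
          fun z : V × ℤ => (if c₂ * l₁ z.1 < c₁ * l₂ z.1 then a z.1 else 0) *
            ((z.2 : ℚ) ^ k * h z.2) * (if l₂ z.1 < c₂ * z.2 + b₂ then 1 else 0) := by
        funext z
        rw [ite_cut_mul_ite_cut h₁ h₂ hb₁ hb₂ hle]
        simp only [Pi.add_apply, ← mul_boole _ (a z.1)]
        ring
      rw [e]
      have hle : IsPiecewiseSet {x | (c₁ : ℤ) * l₂ x ≤ c₂ * l₁ x} := by
        simpa using isPiecewiseSet_le (c₁ • l₂) (c₂ • l₁)
      have hlt : IsPiecewiseSet {x | (c₂ : ℤ) * l₁ x < c₁ * l₂ x} := by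
        simpa using isPiecewiseSet_lt (c₂ • l₁) (c₁ • l₂)
      exact add_mem
        (Submodule.subset_span (IsCutTerm.mk _ (hle.ite_mem ha) k h K hK hper l₁ c₁ h₁ b₁ hb₁))
        (Submodule.subset_span (IsCutTerm.mk _ (hlt.ite_mem ha) k h K hK hper l₂ c₂ h₂ b₂ hb₂))
    rcases le_total b b' with hle | hle
    · convert key l l' c c' b b' hc hc' hb hb' hle using 2 with z
      ring
    · convert key l' l c' c b' b hc' hc hb' hb hle using 2 with z
      ring

lemma map_prod_eq (l : V × ℤ →+ ℤ) (z : V × ℤ) :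
    l z = l.comp (AddMonoidHom.inl V ℤ) z.1 + l (0, 1) * z.2 := by
  have h : z = (z.1, 0) + z.2 • ((0, 1) : V × ℤ) := by ext <;> simp
  conv_lhs => rw [h, map_add, map_zsmul]
  simp [mul_comm]

lemma IsCutTerm.generator_mul {g : V × ℤ → ℚ} (hg : IsCutTerm g) {q : V × ℤ → ℚ}
    (hq : IsPiecewiseGenerator q) : q * g ∈ cutSpan V := by
  cases hq with
  | linear l =>
    set l' := l.comp (AddMonoidHom.inl V ℤ)
    have e : (fun z => (l z : ℚ)) * g =
        (fun z => ((l' z.1 : ℚ)) * g z) + (l (0, 1) : ℚ) • fun z => z.2 * g z := by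
      funext z
      simp only [Pi.mul_apply, Pi.add_apply, Pi.smul_apply, smul_eq_mul]
      rw [map_prod_eq l z]
      push_cast
      ring
    rw [e]
    exact add_mem (Submodule.subset_span (hg.coeff_mul (linear_mem_piecewise l')))
      (Submodule.smul_mem _ _ (Submodule.subset_span hg.var_mul))
  | periodic l h K hK hper =>
    set l' := l.comp (AddMonoidHom.inl V ℤ)
    have e : (fun z => h (l z)) * g = ∑ s ∈ Finset.range K, fun z : V × ℤ =>
        (if l' z.1 % (K : ℤ) = s then 1 else 0) * (h (s + l (0, 1) * z.2) * g z) := by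
      funext z
      simp only [Pi.mul_apply, Finset.sum_apply]
      rw [map_prod_eq l z, periodic_eq_sum hK (h := fun m => h (m + l (0, 1) * z.2))
        (fun m => by simp only [add_right_comm m (K : ℤ)]; exact hper _) (l' z.1), Finset.sum_mul]
      refine Finset.sum_congr rfl fun s _ => ?_
      split_ifs <;> simp
    rw [e]
    refine sum_mem fun s _ => Submodule.subset_span ?_
    refine (hg.periodic_mul (h := fun y => h (s + l (0, 1) * y)) hK fun y => ?_).coeff_mul
      (a := fun x => if l' x % (K : ℤ) = s then 1 else 0) ?_
    · have e2 : (s : ℤ) + l (0, 1) * (y + K) = s + l (0, 1) * y + l (0, 1) * K := by ring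
      simp only [e2]
      exact hper.int_mul _ _
    · refine periodic_mem_piecewise l' hK (h := fun m => if m % (K : ℤ) = s then 1 else 0) ?_
      intro m
      simp
  | pos l =>
    set l' := l.comp (AddMonoidHom.inl V ℤ)
    rcases lt_trichotomy (l (0, 1)) 0 with hc | hc | hc
    · obtain ⟨c, hc'⟩ := Int.eq_ofNat_of_zero_le (neg_nonneg.2 hc.le)
      have e : (fun z => if 0 < l z then (1 : ℚ) else 0) * g =
          g - fun z => (if l' z.1 < c * z.2 + 1 then 1 else 0) * g z := by
        funext z
        simp only [Pi.mul_apply, Pi.sub_apply]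
        have : 0 < l z ↔ ¬ l' z.1 < c * z.2 + 1 := by
          rw [map_prod_eq l z, ← hc']
          change 0 < l' z.1 + _ ↔ _
          constructor <;> intro h <;> linarith
        by_cases h : l' z.1 < c * z.2 + 1 <;> simp [this, h]
      rw [e]
      exact sub_mem (Submodule.subset_span hg) (hg.cut_mul l' (by omega) (.inr rfl))
    · have e : (fun z => if 0 < l z then (1 : ℚ) else 0) * g =
          fun z => (if 0 < l' z.1 then 1 else 0) * g z := by
        funext z
        simp only [Pi.mul_apply]
        rw [map_prod_eq l z, hc, zero_mul, add_zero]
      rw [e]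
      exact Submodule.subset_span (hg.coeff_mul (pos_mem_piecewise l'))
    · obtain ⟨c, hc'⟩ := Int.eq_ofNat_of_zero_le hc.le
      have e : (fun z => if 0 < l z then (1 : ℚ) else 0) * g =
          fun z => (if (-l') z.1 < c * z.2 + 0 then 1 else 0) * g z := by
        funext z
        simp only [Pi.mul_apply]
        have : 0 < l z ↔ (-l') z.1 < c * z.2 + 0 := by
          rw [map_prod_eq l z, ← hc']
          change 0 < l' z.1 + _ ↔ - l' z.1 < _
          constructor <;> intro h <;> linarith
        simp only [this]
      rw [e]
      exact hg.cut_mul (-l') (by omega) (.inl rfl)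

lemma generator_mul_mem_cutSpan {q : V × ℤ → ℚ} (hq : IsPiecewiseGenerator q) {g : V × ℤ → ℚ}
    (hg : g ∈ cutSpan V) : q * g ∈ cutSpan V := by
  induction hg using Submodule.span_induction with
  | mem g hg => exact IsCutTerm.generator_mul hg hq
  | zero => rw [mul_zero]; exact zero_mem _
  | add x y _ _ hx hy => rw [mul_add]; exact add_mem hx hy
  | smul a x _ hx => rw [mul_smul_comm]; exact Submodule.smul_mem _ _ hx

lemma mul_mem_cutSpan {q : V × ℤ → ℚ} (hq : q ∈ piecewiseQuasiPoly (V × ℤ)) :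
    ∀ g ∈ cutSpan V, q * g ∈ cutSpan V := by
  induction hq using Algebra.adjoin_induction with
  | mem q hq => exact fun g hg => generator_mul_mem_cutSpan hq hg
  | algebraMap r =>
    intro g hg
    rw [← Algebra.smul_def]
    exact Submodule.smul_mem _ _ hg
  | add x y _ _ hx hy =>
    intro g hg
    rw [add_mul]
    exact add_mem (hx g hg) (hy g hg)
  | mul x y _ _ hx hy =>
    intro g hg
    rw [mul_assoc]
    exact hx _ (hy g hg)

lemma IsCutTerm.sum_mem {g : V × ℤ → ℚ} (hg : IsCutTerm g) (φ : V →+ ℤ) :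
    (fun x => ∑ y ∈ Finset.Ioo 0 (φ x), g (x, y)) ∈ piecewiseQuasiPoly V := by
  cases hg with
  | mk a ha k h K hK hper l c hc b hb =>
    have hc' : (0 : ℤ) < c := by exact_mod_cast hc
    obtain ⟨F, hF, hdiff⟩ := exists_antidifference k hK hper
    have e : (fun x => ∑ y ∈ Finset.Ioo 0 (φ x),
          a x * ((y : ℚ) ^ k * h y) * if l x < c * y + b then 1 else 0) =
        a * ((fun x => if l x < (0 : V →+ ℤ) x + b then
            (if (0 : V →+ ℤ) x < φ x then F ((φ x - 1) / (1 : ℕ)) - F 0 else 0) else 0) +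
          fun x => if ¬ l x < (0 : V →+ ℤ) x + b then
            (if l x < c * φ x + b then F ((φ x - 1) / (1 : ℕ)) - F ((l x - b) / c) else 0)
            else 0) := by
      funext x
      simp only [Pi.mul_apply, Pi.add_apply, AddMonoidHom.zero_apply, zero_add, Nat.cast_one,
        Int.ediv_one, mul_assoc, ← Finset.mul_sum]
      congr 1
      by_cases hl : l x < b
      · simp only [hl, not_true, if_true, if_false, add_zero]
        have : ∀ y ∈ Finset.Ioo 0 (φ x), (y : ℚ) ^ k * (h y * if l x < c * y + b then 1 else 0) =
            (y : ℚ) ^ k * h y := by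
          intro y hy
          rw [if_pos, mul_one]
          nlinarith [(Finset.mem_Ioo.1 hy).1]
        rw [Finset.sum_congr rfl this]
        split_ifs with h0
        · exact sum_Ioo_of_antidifference hdiff h0
        · rw [Finset.Ioo_eq_empty h0, Finset.sum_empty]
      · simp only [hl, not_false_iff, if_true, if_false, zero_add]
        have hT : ∀ y : ℤ, l x < c * y + b ↔ (l x - b) / c < y := by
          intro y
          rw [Int.ediv_lt_iff_lt_mul hc']
          constructor <;> intro h <;> linarith
        have hT0 : 0 ≤ (l x - b) / (c : ℤ) := Int.ediv_nonneg (by linarith) hc'.le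
        have hfil : (Finset.Ioo 0 (φ x)).filter (fun y => (l x - b) / (c : ℤ) < y) =
            Finset.Ioo ((l x - b) / (c : ℤ)) (φ x) := by
          ext y
          simp only [Finset.mem_filter, Finset.mem_Ioo]
          omega
        simp only [hT, mul_ite, mul_one, mul_zero]
        rw [← Finset.sum_filter, hfil]
        split_ifs with h0
        · exact sum_Ioo_of_antidifference hdiff h0
        · rw [Finset.Ioo_eq_empty h0, Finset.sum_empty]
    rw [e]
    have h1 := isPiecewiseSet_lt_add l 0 hb
    have h2 := isPiecewiseSet_lt (0 : V →+ ℤ) φ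
    have h3 : IsPiecewiseSet {x | l x < c * φ x + b} := by
      simpa using isPiecewiseSet_lt_add l (c • φ) hb
    have hφ := quasiPoly_ediv_mem_piecewise hF φ 1 one_pos
    exact mul_mem ha (add_mem
      (h1.ite_mem (h2.ite_mem (sub_mem hφ (const_mem_piecewise _))))
      (h1.compl.ite_mem (h3.ite_mem (sub_mem hφ (quasiPoly_ediv_mem_piecewise hF l b hc)))))

lemma sum_Ioo_mem_piecewise {g : V × ℤ → ℚ} (hg : g ∈ piecewiseQuasiPoly (V × ℤ)) (φ : V →+ ℤ) :
    (fun x => ∑ y ∈ Finset.Ioo 0 (φ x), g (x, y)) ∈ piecewiseQuasiPoly V := by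
  have key : ∀ g ∈ cutSpan V,
      (fun x => ∑ y ∈ Finset.Ioo 0 (φ x), g (x, y)) ∈ piecewiseQuasiPoly V := by
    intro g hg
    induction hg using Submodule.span_induction with
    | mem g hg => exact IsCutTerm.sum_mem hg φ
    | zero => simpa using const_mem_piecewise (V := V) 0
    | add x y _ _ hx hy =>
      simp only [Pi.add_apply, Finset.sum_add_distrib]
      exact add_mem hx hy
    | smul a x _ hx =>
      simp only [Pi.smul_apply, ← Finset.smul_sum]
      exact (piecewiseQuasiPoly V).smul_mem hx a
  have h1 : IsCutTerm (V := V) fun z => (1 : V → ℚ) z.1 * ((z.2 : ℚ) ^ 0 * (1 : ℤ → ℚ) z.2) *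
      if (0 : V →+ ℤ) z.1 < (1 : ℕ) * z.2 + 0 then 1 else 0 :=
    IsCutTerm.mk 1 (one_mem _) 0 1 1 one_pos (fun _ => rfl) 0 1 one_pos 0 (.inl rfl)
  convert key _ (mul_mem_cutSpan hg _ (Submodule.subset_span h1)) using 2 with x
  refine Finset.sum_congr rfl fun y hy => ?_
  have := (Finset.mem_Ioo.1 hy).1
  simp [this]

lemma sum_piFinset_Ioo_mem_piecewise (m : ℕ) : ∀ (V : Type) [AddCommGroup V] (φ : V →+ ℤ)
    (g : V × (Fin m → ℤ) → ℚ), g ∈ piecewiseQuasiPoly (V × (Fin m → ℤ)) →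
    (fun x => ∑ a ∈ Fintype.piFinset fun _ : Fin m => Finset.Ioo 0 (φ x), g (x, a)) ∈
      piecewiseQuasiPoly V := by
  induction m with
  | zero =>
    intro V _ φ g hg
    have := comp_mem_piecewise (AddMonoidHom.inl V (Fin 0 → ℤ)) hg
    convert this using 2 with x
    simp
    rfl
  | succ m ih =>
    intro V _ φ g hg
    let ψ : (V × ℤ) × (Fin m → ℤ) →+ V × (Fin (m + 1) → ℤ) :=
      { toFun := fun z => (z.1.1, Fin.cons z.1.2 z.2)
        map_zero' := by
          ext i
          · rfl
          · refine Fin.cases ?_ (fun j => ?_) i <;> simp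
        map_add' := fun z w => by
          ext i
          · rfl
          · refine Fin.cases ?_ (fun j => ?_) i <;> simp }
    have h := sum_Ioo_mem_piecewise (ih (V × ℤ) (φ.comp (AddMonoidHom.fst V ℤ)) _
      (comp_mem_piecewise ψ hg)) φ
    convert h using 2 with x
    simp only [AddMonoidHom.comp_apply, AddMonoidHom.coe_fst]
    rw [← Finset.sum_product' (Finset.Ioo 0 (φ x))
      (Fintype.piFinset fun _ : Fin m => Finset.Ioo 0 (φ x)) fun y a => g (ψ ((x, y), a))]
    refine Finset.sum_nbij' (fun a => (a 0, Fin.tail a)) (fun z => Fin.cons z.1 z.2) ?_ ?_ ?_ ?_ ?_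
    · intro a ha
      simp only [Fintype.mem_piFinset] at ha
      simp only [Finset.mem_product, Fintype.mem_piFinset]
      exact ⟨ha 0, fun i => ha i.succ⟩
    · intro z hz
      simp only [Finset.mem_product, Fintype.mem_piFinset] at hz
      simp only [Fintype.mem_piFinset]
      exact fun i => Fin.cases hz.1 (fun j => hz.2 j) i
    · intro a _
      exact Fin.cons_self_tail a
    · intro z _
      simp
    · intro a _
      simp only [ψ, AddMonoidHom.coe_mk, ZeroHom.coe_mk, Fin.cons_self_tail]

end Elimination

lemma eval_of_mem_piecewise {g : ℤ → ℚ} (hg : g ∈ piecewiseQuasiPoly ℤ) :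
    ∃ K : ℕ, 0 < K ∧ ∃ p : ℕ → Polynomial ℚ, ∀ f : ℕ, 0 < f → g f = (p (f % K)).eval (f : ℚ) := by
  open Polynomial in
  have hl : ∀ (l : ℤ →+ ℤ) (f : ℕ), l f = f * l 1 := fun l f => by
    conv_lhs => rw [← mul_one (f : ℤ), ← smul_eq_mul, map_zsmul, smul_eq_mul]
  induction hg using Algebra.adjoin_induction with
  | mem g hg =>
    cases hg with
    | linear l => exact ⟨1, one_pos, fun _ => X * C (l 1 : ℚ), fun f _ => by simp [hl l f]⟩
    | periodic l h K hK hper =>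
      refine ⟨K, hK, fun r => C (h (r * l 1)), fun f _ => ?_⟩
      simp only [eval_C, hl l f]
      nth_rewrite 1 [← Nat.mod_add_div f K]
      have e : ((f % K + K * (f / K) : ℕ) : ℤ) * l 1 =
          ((f % K : ℕ) : ℤ) * l 1 + (((f / K : ℕ) : ℤ) * l 1) * K := by push_cast; ring
      rw [e]
      exact hper.int_mul _ _
    | pos l =>
      refine ⟨1, one_pos, fun _ => C (if 0 < l 1 then 1 else 0), fun f hf => ?_⟩
      have hf' : (0 : ℤ) < f := by exact_mod_cast hf
      split_ifs <;> simp_all [mul_pos_iff_of_pos_left hf']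
  | algebraMap r => exact ⟨1, one_pos, fun _ => C r, fun f _ => by simp⟩
  | add x y _ _ hx hy =>
    obtain ⟨K, hK, p, hp⟩ := hx
    obtain ⟨L, hL, q, hq⟩ := hy
    refine ⟨K * L, by positivity, fun r => p (r % K) + q (r % L), fun f hf => ?_⟩
    simp only [Nat.mod_mod_of_dvd _ (dvd_mul_right K L), Nat.mod_mod_of_dvd _ (dvd_mul_left L K)]
    rw [eval_add, ← hp f hf, ← hq f hf]
    rfl
  | mul x y _ _ hx hy =>
    obtain ⟨K, hK, p, hp⟩ := hx
    obtain ⟨L, hL, q, hq⟩ := hy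
    refine ⟨K * L, by positivity, fun r => p (r % K) * q (r % L), fun f hf => ?_⟩
    simp only [Nat.mod_mod_of_dvd _ (dvd_mul_right K L), Nat.mod_mod_of_dvd _ (dvd_mul_left L K)]
    rw [eval_mul, ← hp f hf, ← hq f hf]
    rfl

section Sporadic

/-- The possible sets of `n` positive sporadic elements for the Frobenius number `f`. -/
def sporadicSets (n f : ℕ) : Finset (Finset ℕ) :=
  {A ∈ Finset.powersetCard n (Finset.Ioo 0 f) | ∀ a ∈ A, ∀ b ∈ A, a + b ∈ A ∨ f < a + b}

lemma mem_sporadicSets {n f : ℕ} {A : Finset ℕ} : A ∈ sporadicSets n f ↔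
    (A ⊆ Finset.Ioo 0 f ∧ A.card = n) ∧ ∀ a ∈ A, ∀ b ∈ A, a + b ∈ A ∨ f < a + b := by
  simp [sporadicSets, Finset.mem_powersetCard]

lemma numSgpCount_eq_card (n : ℕ) {f : ℕ} (hf : 0 < f) :
    NumSgpCount n f = (sporadicSets n f).card := by
  let Φ : Finset ℕ → Set ℕ := fun A => {m | m = 0 ∨ m ∈ A ∨ f < m}
  have hΦ : ∀ A : Finset ℕ, A ⊆ Finset.Ioo 0 f → {s ∈ Φ A | 0 < s ∧ s < f} = (A : Set ℕ) := by
    intro A hA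
    ext s
    simp only [Φ, Set.mem_ofPred_eq, Finset.mem_coe]
    constructor
    · rintro ⟨h | h | h, h1, h2⟩
      · omega
      · exact h
      · omega
    · intro h
      exact ⟨.inr (.inl h), Finset.mem_Ioo.1 (hA h)⟩
  have himg : {S : Set ℕ | IsNumericalSemigroup S ∧ IsFrobenius S f ∧
      {s ∈ S | 0 < s ∧ s < f}.ncard = n} = Φ '' (sporadicSets n f : Set (Finset ℕ)) := by
    ext S
    constructor
    · rintro ⟨⟨h0, hadd, -⟩, ⟨hfS, hmax⟩, hn⟩
      have hfin : {s ∈ S | 0 < s ∧ s < f}.Finite :=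
        (Set.finite_Iio f).subset fun s hs => hs.2.2
      refine ⟨hfin.toFinset, ?_, ?_⟩
      · rw [Finset.mem_coe, mem_sporadicSets, ← hn, Set.ncard_eq_toFinset_card _ hfin]
        refine ⟨⟨fun s hs => ?_, rfl⟩, fun a ha b hb => ?_⟩
        · rw [Set.Finite.mem_toFinset] at hs
          exact Finset.mem_Ioo.2 hs.2
        · rw [Set.Finite.mem_toFinset] at ha hb ⊢
          have hab := hadd a ha.1 b hb.1
          rcases lt_trichotomy (a + b) f with h | h | h
          · exact .inl ⟨hab, by have := ha.2.1; omega, h⟩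
          · exact absurd (h ▸ hab) hfS
          · exact .inr h
      · ext m
        simp only [Φ, Set.mem_ofPred_eq, Set.Finite.mem_toFinset]
        constructor
        · rintro (rfl | h | h)
          · exact h0
          · exact h.1
          · by_contra hm
            exact absurd (hmax m hm) (by omega)
        · intro hm
          rcases lt_trichotomy m f with h | h | h
          · rcases Nat.eq_zero_or_pos m with h' | h'
            · exact .inl h'
            · exact .inr (.inl ⟨hm, h', h⟩)
          · exact absurd (h ▸ hm) hfS
          · exact .inr (.inr h)
    · rintro ⟨A, hA, rfl⟩
      rw [Finset.mem_coe, mem_sporadicSets] at hA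
      obtain ⟨⟨hsub, hcard⟩, hadd⟩ := hA
      refine ⟨⟨.inl rfl, ?_, ?_⟩, ⟨?_, ?_⟩, ?_⟩
      · intro a ha b hb
        simp only [Φ, Set.mem_ofPred_eq] at ha hb ⊢
        rcases ha with rfl | ha | ha
        · simpa using hb
        · rcases hb with rfl | hb | hb
          · exact .inr (.inl ha)
          · exact .inr (hadd a ha b hb)
          · omega
        · omega
      · refine (Set.finite_Iic f).subset fun m hm => ?_
        simp only [Φ, Set.mem_compl_iff, Set.mem_ofPred_eq, not_or] at hm
        exact not_lt.1 hm.2.2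
      · rintro (h | h | h)
        · omega
        · exact absurd (Finset.mem_Ioo.1 (hsub h)).2 (lt_irrefl _)
        · exact lt_irrefl _ h
      · intro m hm
        simp only [Φ, Set.mem_ofPred_eq, not_or] at hm
        exact not_lt.1 hm.2.2
      · rw [hΦ A hsub, Set.ncard_coe_finset, hcard]
  rw [NumSgpCount, himg, Set.InjOn.ncard_image, Set.ncard_coe_finset]
  intro A hA B hB hAB
  rw [Finset.mem_coe, mem_sporadicSets] at hA hB
  have h := hΦ A hA.1.1
  rw [hAB, hΦ B hB.1.1] at h
  exact (Finset.coe_injective h).symm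

/-- The pairs `(f, a)` such that `a` is the increasing enumeration of the positive sporadic elements
of a numerical semigroup with Frobenius number `f`. -/
def sporadicTuples (n : ℕ) : Set (ℤ × (Fin n → ℤ)) :=
  (⋂ i, ⋂ j, {z | i < j → z.2 i < z.2 j}) ∩
    ⋂ i, ⋂ j, ((⋃ k, {z | z.2 i + z.2 j = z.2 k}) ∪ {z | z.1 < z.2 i + z.2 j})

lemma mem_sporadicTuples {n : ℕ} {z : ℤ × (Fin n → ℤ)} : z ∈ sporadicTuples n ↔
    StrictMono z.2 ∧ ∀ i j, (∃ k, z.2 i + z.2 j = z.2 k) ∨ z.1 < z.2 i + z.2 j := by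
  simp [sporadicTuples, StrictMono]

lemma isPiecewiseSet_sporadicTuples (n : ℕ) : IsPiecewiseSet (sporadicTuples n) := by
  let e : Fin n → (ℤ × (Fin n → ℤ)) →+ ℤ := fun i =>
    (Pi.evalAddMonoidHom (fun _ => ℤ) i).comp (AddMonoidHom.snd ℤ (Fin n → ℤ))
  refine .inter (.iInter fun i => .iInter fun j => ?_) (.iInter fun i => .iInter fun j =>
    .union (.iUnion fun k => isPiecewiseSet_eq (e i + e j) (e k))
      (isPiecewiseSet_lt (AddMonoidHom.fst ℤ _) (e i + e j)))
  by_cases hij : i < j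
  · simp only [hij, true_imp_iff]
    exact isPiecewiseSet_lt (e i) (e j)
  · simp only [hij, false_imp_iff, IsPiecewiseSet]
    rw [show {z : ℤ × (Fin n → ℤ) | True} = Set.univ from rfl, Set.indicator_univ]
    exact one_mem _

lemma card_sporadicSets_eq_sum (n f : ℕ) : ((sporadicSets n f).card : ℚ) =
    ∑ a ∈ Fintype.piFinset fun _ : Fin n => Finset.Ioo (0 : ℤ) f,
      (sporadicTuples n).indicator 1 ((f : ℤ), a) := by
  classical
  simp only [Set.indicator_apply, Pi.one_apply]
  rw [Finset.sum_boole, Nat.cast_inj]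
  symm
  refine Finset.card_nbij (fun a => Finset.univ.image fun i => (a i).toNat) ?_ ?_ ?_
  · intro a ha
    simp only [Finset.coe_filter, Set.mem_ofPred_eq, Fintype.mem_piFinset, Finset.mem_Ioo,
      mem_sporadicTuples] at ha
    obtain ⟨hr, hmono, hadd⟩ := ha
    rw [Finset.mem_coe, mem_sporadicSets]
    refine ⟨⟨?_, ?_⟩, ?_⟩
    · intro m hm
      obtain ⟨i, -, rfl⟩ := Finset.mem_image.1 hm
      have := hr i
      rw [Finset.mem_Ioo]
      omega
    · rw [Finset.card_image_of_injective, Finset.card_univ, Fintype.card_fin]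
      intro i j hij
      apply hmono.injective
      have := hr i
      have := hr j
      simp only at hij
      omega
    · simp only [Finset.mem_image, Finset.mem_univ, true_and, forall_exists_index,
        forall_apply_eq_imp_iff]
      intro i j
      have := hr i
      have := hr j
      rcases hadd i j with ⟨k, hk⟩ | h
      · exact .inl ⟨k, by omega⟩
      · exact .inr (by omega)
  · intro a ha b hb hab
    simp only [Finset.coe_filter, Set.mem_ofPred_eq, Fintype.mem_piFinset, Finset.mem_Ioo,
      mem_sporadicTuples] at ha hb
    have key : ∀ c : Fin n → ℤ, (∀ i, 0 < c i ∧ c i < f) → StrictMono c →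
        StrictMono fun i => (c i).toNat := by
      intro c hc hmono i j hij
      have := hmono hij
      have := hc i
      simp only
      omega
    have h := (StrictMono.range_inj (key a ha.1 ha.2.1) (key b hb.1 hb.2.1)).1 (by
      have := congrArg (fun s : Finset ℕ => (s : Set ℕ)) hab
      simpa using this)
    funext i
    have := congrFun h i
    have := ha.1 i
    have := hb.1 i
    simp only at *
    omega
  · intro A hA
    rw [Finset.mem_coe, mem_sporadicSets] at hA
    obtain ⟨⟨hsub, hcard⟩, hadd⟩ := hA
    have hmem := A.orderEmbOfFin_mem hcard
    have hsurj : ∀ m ∈ A, ∃ i, A.orderEmbOfFin hcard i = m := by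
      intro m hm
      have := A.range_orderEmbOfFin hcard
      rw [← Finset.mem_coe, ← this] at hm
      exact hm
    refine ⟨fun i => (A.orderEmbOfFin hcard i : ℤ), ?_, ?_⟩
    · simp only [Finset.coe_filter, Set.mem_ofPred_eq, Fintype.mem_piFinset, Finset.mem_Ioo,
        mem_sporadicTuples]
      refine ⟨fun i => ?_, ?_, fun i j => ?_⟩
      · have := Finset.mem_Ioo.1 (hsub (hmem i))
        omega
      · intro i j hij
        exact Int.ofNat_lt.2 ((A.orderEmbOfFin hcard).strictMono hij)
      · rcases hadd _ (hmem i) _ (hmem j) with h | h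
        · obtain ⟨k, hk⟩ := hsurj _ h
          exact .inl ⟨k, by rw [hk]; push_cast; rfl⟩
        · exact .inr (by exact_mod_cast h)
    · ext m
      simp only [Int.toNat_natCast, Finset.mem_image, Finset.mem_univ, true_and]
      exact ⟨by rintro ⟨i, rfl⟩; exact hmem i, hsurj m⟩

lemma choose_le_card_sporadicSets (n f : ℕ) :
    (f - f / 2 - 1).choose n ≤ (sporadicSets n f).card := by
  rw [← Nat.card_Ioo, ← Finset.card_powersetCard]
  refine Finset.card_le_card fun A hA => ?_
  rw [Finset.mem_powersetCard] at hA
  refine mem_sporadicSets.2 ⟨⟨hA.1.trans (Finset.Ioo_subset_Ioo_left (Nat.zero_le _)), hA.2⟩,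
    fun a ha b hb => .inr ?_⟩
  have := Finset.mem_Ioo.1 (hA.1 ha)
  have := Finset.mem_Ioo.1 (hA.1 hb)
  omega

lemma card_sporadicSets_le (n f : ℕ) :
    (sporadicSets (n + 1) f).card ≤ (f - f / 2 - 1).choose (n + 1) + f ^ n * n := by
  classical
  let B : Finset (Finset ℕ) := (Finset.powersetCard n (Finset.range f)).biUnion
    fun A => A.image fun a => insert (a + a) A
  have hB : B.card ≤ f ^ n * n := by
    refine (Finset.card_biUnion_le_card_mul _ _ n fun A hA => ?_).trans ?_
    · exact Finset.card_image_le.trans (Finset.mem_powersetCard.1 hA).2.le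
    · rw [Finset.card_powersetCard, Finset.card_range]
      exact Nat.mul_le_mul_right _ (Nat.choose_le_pow f n)
  rw [← Nat.card_Ioo, ← Finset.card_powersetCard]
  refine le_trans ?_ (Nat.add_le_add_left hB _)
  refine le_trans (Finset.card_le_card fun A hA => ?_) (Finset.card_union_le _ _)
  obtain ⟨⟨hsub, hcard⟩, hadd⟩ := mem_sporadicSets.1 hA
  rw [Finset.mem_union]
  by_cases h : ∀ a ∈ A, f / 2 < a
  · exact .inl (Finset.mem_powersetCard.2
      ⟨fun a ha => Finset.mem_Ioo.2 ⟨h a ha, (Finset.mem_Ioo.1 (hsub ha)).2⟩, hcard⟩)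
  · push Not at h
    obtain ⟨a, ha, hle⟩ := h
    have h0 := Finset.mem_Ioo.1 (hsub ha)
    have h2 : a + a ∈ A := (hadd a ha a ha).resolve_right (by omega)
    refine .inr (Finset.mem_biUnion.2 ⟨A.erase (a + a), Finset.mem_powersetCard.2 ⟨?_, ?_⟩,
      Finset.mem_image.2 ⟨a, ?_, Finset.insert_erase h2⟩⟩)
    · intro b hb
      exact Finset.mem_range.2 (Finset.mem_Ioo.1 (hsub (Finset.mem_of_mem_erase hb))).2
    · rw [Finset.card_erase_of_mem h2, hcard, Nat.add_sub_cancel]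
    · exact Finset.mem_erase.2 ⟨by omega, ha⟩

open Filter Topology Asymptotics in
lemma tendsto_card_sporadicSets (n : ℕ) :
    Tendsto (fun f : ℕ => ((sporadicSets (n + 1) f).card : ℝ) / (f : ℝ) ^ (n + 1)) atTop
      (𝓝 (1 / (2 ^ (n + 1) * (n + 1).factorial))) := by
  have hinv : Tendsto (fun f : ℕ => 1 / (f : ℝ)) atTop (𝓝 0) :=
    tendsto_one_div_atTop_nhds_zero_nat
  have hm : Tendsto (fun f : ℕ => ((f - f / 2 - 1 : ℕ) : ℝ) / f) atTop (𝓝 (1 / 2)) := by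
    have hlow : Tendsto (fun f : ℕ => 1 / 2 - 1 / (f : ℝ)) atTop (𝓝 (1 / 2)) := by
      simpa using hinv.const_sub (1 / 2 : ℝ)
    refine tendsto_of_tendsto_of_tendsto_of_le_of_le' hlow tendsto_const_nhds ?_ ?_
    · filter_upwards [eventually_gt_atTop 0] with f hf
      have hf' : (0 : ℝ) < f := by exact_mod_cast hf
      have h : (f : ℝ) ≤ 2 * ((f - f / 2 - 1 : ℕ) : ℝ) + 2 := by
        exact_mod_cast (by omega : f ≤ 2 * (f - f / 2 - 1) + 2)
      rw [le_div_iff₀ hf', sub_mul, one_div_mul_cancel hf'.ne']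
      linarith
    · filter_upwards [eventually_gt_atTop 0] with f hf
      have hf' : (0 : ℝ) < f := by exact_mod_cast hf
      have h : 2 * ((f - f / 2 - 1 : ℕ) : ℝ) ≤ f := by
        exact_mod_cast (by omega : 2 * (f - f / 2 - 1) ≤ f)
      rw [div_le_iff₀ hf']
      linarith
  have hmtop : Tendsto (fun f : ℕ => f - f / 2 - 1) atTop atTop :=
    tendsto_atTop.2 fun b => by
      filter_upwards [eventually_ge_atTop (2 * b + 2)] with f hf
      omega
  have hchoose : Tendsto (fun f : ℕ => ((f - f / 2 - 1).choose (n + 1) : ℝ) / (f : ℝ) ^ (n + 1))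
      atTop (𝓝 (1 / (2 ^ (n + 1) * (n + 1).factorial))) := by
    have h1 := ((isEquivalent_choose (n + 1)).comp_tendsto hmtop).div
      (IsEquivalent.refl (u := fun f : ℕ => (f : ℝ) ^ (n + 1)))
    refine h1.symm.tendsto_nhds ?_
    have h2 := (hm.pow (n + 1)).div_const ((n + 1).factorial : ℝ)
    convert h2 using 2
    · simp [div_pow, div_right_comm]
    · simp [div_eq_mul_inv]
      ring
  have herr : Tendsto (fun f : ℕ => (n : ℝ) * (1 / (f : ℝ))) atTop (𝓝 0) := by
    simpa using hinv.const_mul (n : ℝ)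
  have hup := hchoose.add herr
  rw [add_zero] at hup
  refine tendsto_of_tendsto_of_tendsto_of_le_of_le' hchoose hup ?_ ?_
  · filter_upwards with f
    gcongr
    exact choose_le_card_sporadicSets _ _
  · filter_upwards [eventually_gt_atTop 0] with f hf
    have hf' : (0 : ℝ) < f := by exact_mod_cast hf
    have h : ((sporadicSets (n + 1) f).card : ℝ) ≤
        (f - f / 2 - 1).choose (n + 1) + (f : ℝ) ^ n * n := by
      exact_mod_cast card_sporadicSets_le n f
    calc ((sporadicSets (n + 1) f).card : ℝ) / (f : ℝ) ^ (n + 1)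
        ≤ ((f - f / 2 - 1).choose (n + 1) + (f : ℝ) ^ n * n) / (f : ℝ) ^ (n + 1) := by gcongr
      _ = _ := by
        rw [add_div]
        congr 1
        field_simp
        ring

end Sporadic

open Filter Topology in
lemma Polynomial.degree_eq_and_leadingCoeff_eq_of_tendsto {P : Polynomial ℝ} {u : ℕ → ℝ}
    (hu : Tendsto u atTop atTop) {n : ℕ} {L : ℝ} (hL : L ≠ 0)
    (h : Tendsto (fun t => P.eval (u t) / u t ^ n) atTop (𝓝 L)) :
    P.degree = n ∧ P.leadingCoeff = L := by
  have hX : (Polynomial.X ^ n : Polynomial ℝ).degree = n := Polynomial.degree_X_pow n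
  rcases lt_trichotomy P.degree n with hd | hd | hd
  · have h0 := (P.div_tendsto_atTop_zero_of_degree_lt (Polynomial.X ^ n) (hX ▸ hd)).comp hu
    simp only [Function.comp_def, Polynomial.eval_pow, Polynomial.eval_X] at h0
    exact absurd (tendsto_nhds_unique h h0) hL
  · have h0 := (P.div_tendsto_atTop_leadingCoeff_div_of_degree_eq
      (Polynomial.X ^ n) (hd.trans hX.symm)).comp hu
    simp only [Function.comp_def, Polynomial.eval_pow, Polynomial.eval_X,
      (Polynomial.monic_X_pow n).leadingCoeff, div_one] at h0
    exact ⟨hd, tendsto_nhds_unique h0 h⟩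
  · have h0 := (P.abs_div_tendsto_atTop_atTop_of_degree_gt (Polynomial.X ^ n) (hX ▸ hd)
      (Polynomial.monic_X_pow n).ne_zero).comp hu
    simp only [Function.comp_def, Polynomial.eval_pow, Polynomial.eval_X] at h0
    exact absurd h.abs (not_tendsto_nhds_of_tendsto_atTop h0 _)

/-- For fixed `n`, the number of numerical semigroups with Frobenius number `f` and
`n + 1` sporadic elements (i.e. `n` positive sporadic elements) is a quasi-polynomial in
`f` of degree `n`, each of whose constituent polynomials has leading coefficient
`1 / (2^n · n!)`. -/
theorem numerical_semigroup_count_quasipolynomial (n : ℕ) (hn : 0 < n) :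
    ∃ (K : ℕ) (hK : 0 < K) (p : Fin K → Polynomial ℚ),
      (∀ f : ℕ, 0 < f →
        (NumSgpCount n f : ℚ) = (p ⟨f % K, Nat.mod_lt f hK⟩).eval (f : ℚ)) ∧
      (∀ i, (p i).degree = (n : ℕ) ∧
        (p i).leadingCoeff = 1 / (2 ^ n * (Nat.factorial n))) := by
  obtain ⟨K, hK, p, hp⟩ := eval_of_mem_piecewise (sum_piFinset_Ioo_mem_piecewise n ℤ
    (AddMonoidHom.id ℤ) _ (isPiecewiseSet_sporadicTuples n))
  simp only [AddMonoidHom.id_apply, ← card_sporadicSets_eq_sum] at hp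
  refine ⟨K, hK, fun i => p i, fun f hf => ?_, fun i => ?_⟩
  · rw [numSgpCount_eq_card n hf, hp f hf]
  · obtain ⟨n, rfl⟩ := Nat.exists_eq_succ_of_ne_zero hn.ne'
    have hseq : Filter.Tendsto (fun t : ℕ => i + K * (t + 1)) Filter.atTop Filter.atTop :=
      Filter.tendsto_atTop_mono (fun t => by simp only [id]; nlinarith) Filter.tendsto_id
    have h := (tendsto_card_sporadicSets n).comp hseq
    have hval : ∀ t : ℕ, ((sporadicSets (n + 1) (i + K * (t + 1))).card : ℝ) =
        ((p i).map (algebraMap ℚ ℝ)).eval ((i + K * (t + 1) : ℕ) : ℝ) := by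
      intro t
      have h1 := hp (i + K * (t + 1)) (by positivity)
      rw [Nat.add_mul_mod_self_left, Nat.mod_eq_of_lt i.2] at h1
      have h2 := congrArg (algebraMap ℚ ℝ) h1
      rw [← Polynomial.eval_map_apply] at h2
      simpa using h2
    simp only [Function.comp_def, hval] at h
    have hfin := Polynomial.degree_eq_and_leadingCoeff_eq_of_tendsto
      (tendsto_natCast_atTop_atTop.comp hseq) (by positivity) h
    rw [Polynomial.degree_map, Polynomial.leadingCoeff_map] at hfin
    refine ⟨hfin.1, (algebraMap ℚ ℝ).injective ?_⟩
    rw [hfin.2]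
    simp
end

section
/- For every positive integer f, the number of numerical semigroups with Frobenius number f having exactly one positive sporadic element equals (f−1)/2 if f is odd and f/2 − 1 if f is even. Moreover, such semigroups are exactly the sets {0, x, f+1, f+2, …} for integers x with f/2 < x < f. -/
theorem isNumericalSemigroup_and_isFrobenius_and_ncard_eq_one_iff (f : ℕ) (S : Set ℕ) :
    (IsNumericalSemigroup S ∧ IsFrobenius S f ∧ {s ∈ S | 0 < s ∧ s < f}.ncard = 1) ↔
      ∃ x : ℕ, f < 2 * x ∧ x < f ∧ S = {0, x} ∪ {m : ℕ | f + 1 ≤ m} := by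
  constructor
  · rintro ⟨⟨h0, hadd, -⟩, ⟨hfS, hmax⟩, hcard⟩
    obtain ⟨x, hx⟩ := Set.ncard_eq_one.mp hcard
    have hmem (s : ℕ) : (s ∈ S ∧ 0 < s ∧ s < f) ↔ s = x := Set.ext_iff.mp hx s
    obtain ⟨hxS, hx0, hxf⟩ := (hmem x).mpr rfl
    have h2x := hadd x hxS x hxS
    refine ⟨x, ?_, hxf, ?_⟩
    · rcases lt_trichotomy (x + x) f with h | h | h
      · have := (hmem (x + x)).mp ⟨h2x, by omega, h⟩
        omega
      · exact absurd (h ▸ h2x) hfS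
      · omega
    · ext m
      simp only [Set.mem_union, Set.mem_insert_iff, Set.mem_singleton_iff, Set.mem_ofPred_eq]
      constructor
      · intro hm
        have hne : m ≠ f := fun h => hfS (h ▸ hm)
        by_cases hm' : 0 < m ∧ m < f
        · exact .inl (.inr ((hmem m).mp ⟨hm, hm'⟩))
        · omega
      · rintro ((rfl | rfl) | hm)
        · exact h0
        · exact hxS
        · by_contra hmS
          have := hmax m hmS
          omega
  · rintro ⟨x, h2x, hxf, rfl⟩
    refine ⟨⟨by simp, ?_, ?_⟩, ⟨?_, ?_⟩, Set.ncard_eq_one.mpr ⟨x, ?_⟩⟩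
    · intro a ha b hb
      simp only [Set.mem_union, Set.mem_insert_iff, Set.mem_singleton_iff,
        Set.mem_ofPred_eq] at *
      omega
    · refine (Set.finite_Iic f).subset fun m hm => ?_
      simp only [Set.mem_compl_iff, Set.mem_union, Set.mem_ofPred_eq, Set.mem_Iic] at *
      omega
    · simp only [Set.mem_union, Set.mem_insert_iff, Set.mem_singleton_iff, Set.mem_ofPred_eq]
      omega
    · intro m hm
      simp only [Set.mem_union, Set.mem_ofPred_eq] at hm
      omega
    · ext m
      simp only [Set.mem_union, Set.mem_insert_iff, Set.mem_singleton_iff, Set.mem_ofPred_eq]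
      omega

/-- The numerical semigroups with Frobenius number `f` and exactly one positive sporadic
element are counted by `(f-1)/2` for odd `f` and `f/2 - 1` for even `f`, and they are
exactly the sets `{0, x} ∪ {f+1, f+2, …}` for integers `f/2 < x < f`. -/
theorem count_one_sporadic (f : ℕ) (hf : 0 < f) :
    ({S : Set ℕ | IsNumericalSemigroup S ∧ IsFrobenius S f ∧
        {s ∈ S | 0 < s ∧ s < f}.ncard = 1}.ncard
      = if f % 2 = 1 then (f - 1) / 2 else f / 2 - 1) ∧
    (∀ S : Set ℕ,
      (IsNumericalSemigroup S ∧ IsFrobenius S f ∧ {s ∈ S | 0 < s ∧ s < f}.ncard = 1) ↔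
      ∃ x : ℕ, f < 2 * x ∧ x < f ∧ S = {0, x} ∪ {m : ℕ | f + 1 ≤ m}) := by
  refine ⟨?_, isNumericalSemigroup_and_isFrobenius_and_ncard_eq_one_iff f⟩
  have himage : {S : Set ℕ | IsNumericalSemigroup S ∧ IsFrobenius S f ∧
      {s ∈ S | 0 < s ∧ s < f}.ncard = 1} =
      (fun x : ℕ => ({0, x} ∪ {m : ℕ | f + 1 ≤ m} : Set ℕ)) '' (Finset.Ioo (f / 2) f) := by
    ext S
    simp only [Set.mem_ofPred_eq, isNumericalSemigroup_and_isFrobenius_and_ncard_eq_one_iff,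
      Set.mem_image, Finset.coe_Ioo, Set.mem_Ioo]
    constructor
    · rintro ⟨x, h2x, hxf, rfl⟩
      exact ⟨x, ⟨by omega, hxf⟩, rfl⟩
    · rintro ⟨x, ⟨h2x, hxf⟩, rfl⟩
      exact ⟨x, by omega, hxf, rfl⟩
  have hinj : Set.InjOn (fun x : ℕ => ({0, x} ∪ {m : ℕ | f + 1 ≤ m} : Set ℕ))
      (Finset.Ioo (f / 2) f) := by
    intro x hx y _ hxy
    simp only [Finset.coe_Ioo, Set.mem_Ioo] at hx
    have := (Set.ext_iff.mp hxy x).mp (by simp)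
    simp only [Set.mem_union, Set.mem_insert_iff, Set.mem_singleton_iff,
      Set.mem_ofPred_eq] at this
    omega
  rw [himage, hinj.ncard_image, Set.ncard_coe_finset, Nat.card_Ioo]
  split_ifs <;> omega
end

section
/- For every positive integer f, the number N(2,f) of numerical semigroups with Frobenius number f having exactly two positive sporadic elements equals f²/8 + (−14f)/24 if f ≡ 0 (mod 6), f²/8 + (−8f+5)/24 if f ≡ 1 (mod 6), f²/8 + (−14f+16)/24 if f ≡ 2 (mod 6), f²/8 + (−8f−3)/24 if f ≡ 3 (mod 6), f²/8 + (−14f+8)/24 if f ≡ 4 (mod 6), and f²/8 + (−8f+13)/24 if f ≡ 5 (mod 6). -/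
/-- The candidate numerical semigroup with Frobenius number `f` and sporadic set `T`. -/
def sporadicCompletion (f : ℕ) (T : Finset ℕ) : Set ℕ :=
  {n | n = 0 ∨ n ∈ T ∨ f < n}

/-- The two-element sporadic sets with Frobenius number `f`: pairs lying above `f / 2`,
and pairs `{a, 2 * a}` with `f / 3 < a < f / 2`. -/
def sporadicPairs (f : ℕ) : Finset (Finset ℕ) :=
  (Finset.Ioo (f / 2) f).powersetCard 2 ∪
    (Finset.Ioo (f / 3) ((f + 1) / 2)).image fun a => {a, 2 * a}

theorem mem_sporadicPairs {f : ℕ} {T : Finset ℕ} :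
    T ∈ sporadicPairs f ↔
      ∃ a b, a < b ∧ b < f ∧ f < a + b ∧ (f < 2 * a ∨ b = 2 * a) ∧ T = {a, b} := by
  simp only [sporadicPairs, Finset.mem_union, Finset.mem_powersetCard, Finset.mem_image,
    Finset.mem_Ioo]
  constructor
  · rintro (⟨hT, hc⟩ | ⟨a, ha, rfl⟩)
    · obtain ⟨a, b, hab, rfl⟩ := Finset.card_eq_two.1 hc
      have ha := Finset.mem_Ioo.1 (hT (Finset.mem_insert_self a _))
      have hb := Finset.mem_Ioo.1 (hT (Finset.mem_insert_of_mem (Finset.mem_singleton_self b)))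
      rcases hab.lt_or_gt with h | h
      · exact ⟨a, b, h, hb.2, by omega, by omega, rfl⟩
      · exact ⟨b, a, h, ha.2, by omega, by omega, Finset.pair_comm a b⟩
    · exact ⟨a, 2 * a, by omega, by omega, by omega, Or.inr rfl, rfl⟩
  · rintro ⟨a, b, hab, hb, hs, h | rfl, rfl⟩
    · refine Or.inl ⟨fun x hx => ?_, Finset.card_pair hab.ne⟩
      simp only [Finset.mem_insert, Finset.mem_singleton] at hx
      rw [Finset.mem_Ioo]
      omega
    · exact Or.inr ⟨a, by omega, rfl⟩

theorem card_sporadicPairs (f : ℕ) :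
    (sporadicPairs f).card = (f - f / 2 - 1).choose 2 + ((f + 1) / 2 - f / 3 - 1) := by
  rw [sporadicPairs, Finset.card_union_of_disjoint, Finset.card_powersetCard, Nat.card_Ioo,
    Finset.card_image_of_injOn, Nat.card_Ioo]
  · intro a ha b hb h
    have h1 : a ∈ ({b, 2 * b} : Finset ℕ) := by
      rw [← show ({a, 2 * a} : Finset ℕ) = {b, 2 * b} from h]; simp
    have h2 : b ∈ ({a, 2 * a} : Finset ℕ) := by
      rw [show ({a, 2 * a} : Finset ℕ) = {b, 2 * b} from h]; simp
    simp only [Finset.mem_insert, Finset.mem_singleton] at h1 h2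
    omega
  · rw [Finset.disjoint_left]
    intro T hT hT'
    obtain ⟨a, ha, rfl⟩ := Finset.mem_image.1 hT'
    have h := Finset.mem_Ioo.1 ((Finset.mem_powersetCard.1 hT).1 (Finset.mem_insert_self a _))
    rw [Finset.mem_Ioo] at ha
    omega

theorem sporadicCompletion_injOn (f : ℕ) :
    Set.InjOn (sporadicCompletion f) (sporadicPairs f : Set (Finset ℕ)) := by
  intro T hT U hU h
  obtain ⟨a, b, hab, hb, hs, -, rfl⟩ := mem_sporadicPairs.1 (Finset.mem_coe.1 hT)
  obtain ⟨c, d, hcd, hd, hs', -, rfl⟩ := mem_sporadicPairs.1 (Finset.mem_coe.1 hU)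
  ext x
  have hx := Set.ext_iff.1 h x
  simp only [sporadicCompletion, Set.mem_ofPred_eq, Finset.mem_insert,
    Finset.mem_singleton] at hx ⊢
  omega

theorem setOf_two_sporadic_eq_image (f : ℕ) (hf : 0 < f) :
    {S : Set ℕ | IsNumericalSemigroup S ∧ IsFrobenius S f ∧
        {s ∈ S | 0 < s ∧ s < f}.ncard = 2} =
      sporadicCompletion f '' (sporadicPairs f : Set (Finset ℕ)) := by
  ext S
  simp only [Set.mem_ofPred_eq, Set.mem_image, Finset.mem_coe, mem_sporadicPairs]
  constructor
  · rintro ⟨⟨h0, hadd, -⟩, ⟨hfS, hmax⟩, hc⟩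
    obtain ⟨a, b, hab, hT⟩ : ∃ a b, a < b ∧ {s ∈ S | 0 < s ∧ s < f} = {a, b} := by
      obtain ⟨a, b, hab, hT⟩ := Set.ncard_eq_two.1 hc
      rcases hab.lt_or_gt with h | h
      · exact ⟨a, b, h, hT⟩
      · exact ⟨b, a, h, hT.trans (Set.pair_comm a b)⟩
    have hmem (x : ℕ) : x ∈ S ∧ 0 < x ∧ x < f ↔ x = a ∨ x = b := by
      exact Set.ext_iff.1 hT x
    obtain ⟨haS, ha0, haf⟩ := (hmem a).2 (Or.inl rfl)
    obtain ⟨hbS, hb0, hbf⟩ := (hmem b).2 (Or.inr rfl)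
    have hsum {x y : ℕ} (hx : x ∈ S) (hy : y ∈ S) (hx0 : 0 < x) :
        f < x + y ∨ x + y = a ∨ x + y = b := by
      have hxy := hadd x hx y hy
      rcases lt_trichotomy (x + y) f with h | h | h
      · exact Or.inr ((hmem _).1 ⟨hxy, by omega, h⟩)
      · exact absurd (h ▸ hxy) hfS
      · exact Or.inl h
    have h1 := hsum haS haS ha0
    have h2 := hsum haS hbS ha0
    refine ⟨{a, b}, ⟨a, b, hab, hbf, by omega, by omega, rfl⟩, ?_⟩
    ext x
    simp only [sporadicCompletion, Set.mem_ofPred_eq, Finset.mem_insert, Finset.mem_singleton,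
      ← hmem x]
    constructor
    · rintro (rfl | h | h)
      · exact h0
      · exact h.1
      · by_contra hx
        exact absurd (hmax x hx) (by omega)
    · intro hx
      rcases lt_trichotomy x f with h | rfl | h
      · rcases Nat.eq_zero_or_pos x with h' | h'
        · exact Or.inl h'
        · exact Or.inr (Or.inl ⟨hx, h', h⟩)
      · exact absurd hx hfS
      · exact Or.inr (Or.inr h)
  · rintro ⟨T, ⟨a, b, hab, hb, hs, h, rfl⟩, rfl⟩
    have hmem (x : ℕ) :
        x ∈ sporadicCompletion f {a, b} ↔ x = 0 ∨ (x = a ∨ x = b) ∨ f < x := by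
      simp [sporadicCompletion]
    refine ⟨⟨?_, ?_, ?_⟩, ⟨?_, ?_⟩, ?_⟩
    · simp [hmem]
    · intro x hx y hy
      rw [hmem] at *
      omega
    · refine (Set.finite_Iic f).subset fun x hx => ?_
      rw [Set.mem_compl_iff, hmem] at hx
      rw [Set.mem_Iic]
      omega
    · rw [hmem]
      omega
    · intro m hm
      rw [hmem] at hm
      omega
    · rw [← Set.ncard_pair hab.ne]
      congr 1
      ext x
      simp only [Set.mem_ofPred_eq, hmem, Set.mem_insert_iff, Set.mem_singleton_iff]
      omega

/-- Explicit quasi-polynomial formula (with period 6) for the number of numerical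
semigroups with Frobenius number `f` and exactly two positive sporadic elements. -/
theorem count_two_sporadic (f : ℕ) (hf : 0 < f) :
    ({S : Set ℕ | IsNumericalSemigroup S ∧ IsFrobenius S f ∧
        {s ∈ S | 0 < s ∧ s < f}.ncard = 2}.ncard : ℚ)
      = if f % 6 = 0 then (f : ℚ) ^ 2 / 8 + (-14 * (f : ℚ)) / 24
        else if f % 6 = 1 then (f : ℚ) ^ 2 / 8 + (-8 * (f : ℚ) + 5) / 24
        else if f % 6 = 2 then (f : ℚ) ^ 2 / 8 + (-14 * (f : ℚ) + 16) / 24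
        else if f % 6 = 3 then (f : ℚ) ^ 2 / 8 + (-8 * (f : ℚ) - 3) / 24
        else if f % 6 = 4 then (f : ℚ) ^ 2 / 8 + (-14 * (f : ℚ) + 8) / 24
        else (f : ℚ) ^ 2 / 8 + (-8 * (f : ℚ) + 13) / 24 := by
  rw [setOf_two_sporadic_eq_image f hf, (sporadicCompletion_injOn f).ncard_image,
    Set.ncard_coe_finset, card_sporadicPairs]
  push_cast [Nat.cast_choose_two]
  have hm : f - f / 2 - 1 + 1 = 3 * (f / 6) + (f % 6 + 1) / 2 := by omega
  have hn : (f + 1) / 2 - f / 3 - 1 + 1 = f / 6 + ((f % 6 + 1) / 2 - f % 6 / 3) := by omega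
  have hr : f % 6 < 6 := Nat.mod_lt _ (by norm_num)
  have hfq := Nat.div_add_mod f 6
  generalize f - f / 2 - 1 = m at *
  generalize (f + 1) / 2 - f / 3 - 1 = n at *
  generalize f / 6 = q at *
  generalize f % 6 = r at *
  subst hfq
  interval_cases r <;> norm_num <;>
    simp only [Nat.reduceAdd, Nat.reduceDiv, Nat.reduceSub] at hm hn <;>
    (have hm' := congrArg (Nat.cast (R := ℚ)) hm
     have hn' := congrArg (Nat.cast (R := ℚ)) hn
     push_cast at hm' hn'
     rw [eq_sub_of_add_eq hm', eq_sub_of_add_eq hn']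
     ring)
end

section
/- For every positive integer f, the number of numerical semigroups with Frobenius number f whose positive sporadic elements form a two-element set {x_1, x_2} with x_1 < x_2 and x_1 + x_1 = x_2 equals the number of integers in the open interval (f/3, f/2), which is (f−6)/6 if f ≡ 0, (f−1)/6 if f ≡ 1, (f−2)/6 if f ≡ 2, (f−3)/6 if f ≡ 3, (f−4)/6 if f ≡ 4, and (f+1)/6 if f ≡ 5 (mod 6). -/
/-- The set `{0, x, 2x}` together with all integers above `f`. -/
def doubleSporadicSet (f x : ℕ) : Set ℕ :=
  {n | n = 0 ∨ n = x ∨ n = 2 * x ∨ f < n}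

theorem mem_doubleSporadicSet {f x n : ℕ} :
    n ∈ doubleSporadicSet f x ↔ n = 0 ∨ n = x ∨ n = 2 * x ∨ f < n :=
  Iff.rfl

theorem injOn_doubleSporadicSet (f : ℕ) :
    Set.InjOn (doubleSporadicSet f) {x | f < 3 * x ∧ 2 * x < f} := by
  rintro x ⟨hx, hx'⟩ y ⟨hy, hy'⟩ h
  have h₁ : x ∈ doubleSporadicSet f y := h ▸ Or.inr (Or.inl rfl)
  have h₂ : y ∈ doubleSporadicSet f x := h ▸ Or.inr (Or.inl rfl)
  rw [mem_doubleSporadicSet] at h₁ h₂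
  omega

theorem isNumericalSemigroup_doubleSporadicSet {f x : ℕ} (hx : f < 3 * x) :
    IsNumericalSemigroup (doubleSporadicSet f x) := by
  refine ⟨Or.inl rfl, fun a ha b hb => ?_, (Set.finite_Iic f).subset fun n hn => ?_⟩
  · rw [mem_doubleSporadicSet] at *
    omega
  · rw [Set.mem_compl_iff, mem_doubleSporadicSet] at hn
    rw [Set.mem_Iic]
    omega

theorem isFrobenius_doubleSporadicSet {f x : ℕ} (hx : f < 3 * x) (hx' : 2 * x < f) :
    IsFrobenius (doubleSporadicSet f x) f := by
  refine ⟨fun h => ?_, fun m hm => ?_⟩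
  · rw [mem_doubleSporadicSet] at h
    omega
  · rw [mem_doubleSporadicSet] at hm
    omega

/-- The semigroups with two positive sporadic elements `x` and `2x` are exactly the sets
`doubleSporadicSet f x` with `f / 3 < x < f / 2`. -/
theorem setOf_two_sporadic_with_relation (f : ℕ) :
    {S : Set ℕ | IsNumericalSemigroup S ∧ IsFrobenius S f ∧
        ∃ x₁ x₂ : ℕ, x₁ < x₂ ∧ x₁ + x₁ = x₂ ∧
          {s ∈ S | 0 < s ∧ s < f} = {x₁, x₂}}
      = doubleSporadicSet f '' {x | f < 3 * x ∧ 2 * x < f} := by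
  ext S
  constructor
  · rintro ⟨⟨h0, hadd, -⟩, ⟨hf, hmax⟩, x, _, hlt, rfl, hS⟩
    have hmem (n : ℕ) : (n ∈ S ∧ 0 < n ∧ n < f) ↔ (n = x ∨ n = x + x) := Set.ext_iff.mp hS n
    obtain ⟨hx, -, -⟩ := (hmem x).mpr (Or.inl rfl)
    obtain ⟨hxx, -, hxf⟩ := (hmem (x + x)).mpr (Or.inr rfl)
    have h3 : x + x + x ∈ S := hadd _ hxx _ hx
    have h3f : x + x + x ≠ f := fun h => hf (h ▸ h3)
    have h3' := hmem (x + x + x)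
    refine ⟨x, ⟨?_, by omega⟩, Set.ext fun n => ?_⟩
    · by_contra h
      have := h3'.mp ⟨h3, by omega, by omega⟩
      omega
    · rw [mem_doubleSporadicSet]
      constructor
      · rintro (rfl | rfl | rfl | h)
        · exact h0
        · exact hx
        · rwa [two_mul]
        · by_contra hn
          exact absurd (hmax n hn) (by omega)
      · intro hn
        have hnf : n ≠ f := fun h => hf (h ▸ hn)
        by_cases h : 0 < n ∧ n < f
        · have := (hmem n).mp ⟨hn, h⟩
          omega
        · omega
  · rintro ⟨x, ⟨hx, hx'⟩, rfl⟩
    refine ⟨isNumericalSemigroup_doubleSporadicSet hx, isFrobenius_doubleSporadicSet hx hx',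
      x, x + x, by omega, rfl, Set.ext fun n => ?_⟩
    simp only [Set.mem_ofPred_eq, mem_doubleSporadicSet, Set.mem_insert_iff,
      Set.mem_singleton_iff]
    omega

theorem ncard_setOf_lt_three_mul_and_two_mul_lt (f : ℕ) :
    {x : ℕ | f < 3 * x ∧ 2 * x < f}.ncard = (f + 1) / 2 - f / 3 - 1 := by
  have h : {x : ℕ | f < 3 * x ∧ 2 * x < f} = Finset.Ioo (f / 3) ((f + 1) / 2) := by
    ext x
    simp only [Set.mem_ofPred_eq, Finset.coe_Ioo, Set.mem_Ioo]
    omega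
  rw [h, Set.ncard_coe_finset, Nat.card_Ioo]

/-- The number of numerical semigroups with Frobenius number `f` whose positive sporadic
elements are `{x₁, x₂}` with `x₁ < x₂` and `x₁ + x₁ = x₂` equals the number of integers
in the open interval `(f/3, f/2)`, given by an explicit quasi-polynomial of period 6. -/
theorem count_two_sporadic_with_relation (f : ℕ) (hf : 0 < f) :
    ({S : Set ℕ | IsNumericalSemigroup S ∧ IsFrobenius S f ∧
        ∃ x₁ x₂ : ℕ, x₁ < x₂ ∧ x₁ + x₁ = x₂ ∧
          {s ∈ S | 0 < s ∧ s < f} = {x₁, x₂}}.ncard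
      = {x : ℕ | f < 3 * x ∧ 2 * x < f}.ncard) ∧
    ({x : ℕ | f < 3 * x ∧ 2 * x < f}.ncard
      = if f % 6 = 0 then (f - 6) / 6
        else if f % 6 = 1 then (f - 1) / 6
        else if f % 6 = 2 then (f - 2) / 6
        else if f % 6 = 3 then (f - 3) / 6
        else if f % 6 = 4 then (f - 4) / 6
        else (f + 1) / 6) := by
  refine ⟨?_, ?_⟩
  · rw [setOf_two_sporadic_with_relation, (injOn_doubleSporadicSet f).ncard_image]
  · rw [ncard_setOf_lt_three_mul_and_two_mul_lt]
    split_ifs <;> omega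
end

section
/- Let n and f be positive integers. The number of numerical semigroups with Frobenius number f having exactly n positive sporadic elements, all of which are strictly greater than f/2 (equivalently, the sum of any two positive sporadic elements exceeds f), equals the binomial coefficient C(f − ⌊f/2⌋ − 1, n). -/
/-- The set `{0} ∪ A ∪ (f, ∞)`, whose positive sporadic elements are those of `A`
when `A ⊆ (0, f)`. -/
def semigroupOfSporadic (f : ℕ) (A : Finset ℕ) : Set ℕ :=
  {x | x = 0 ∨ x ∈ A ∨ f < x}

theorem sporadic_semigroupOfSporadic {f : ℕ} {A : Finset ℕ}
    (hA : A ⊆ Finset.Ioo (f / 2) f) :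
    {s ∈ semigroupOfSporadic f A | 0 < s ∧ s < f} = (A : Set ℕ) := by
  ext x
  simp only [semigroupOfSporadic, Set.mem_ofPred_eq, Finset.mem_coe]
  constructor
  · rintro ⟨rfl | h | h, h1, h2⟩
    · omega
    · exact h
    · omega
  · intro h
    have := Finset.mem_Ioo.1 (hA h)
    exact ⟨.inr (.inl h), by omega, by omega⟩

theorem isNumericalSemigroup_semigroupOfSporadic {f : ℕ} {A : Finset ℕ}
    (hA : A ⊆ Finset.Ioo (f / 2) f) :
    IsNumericalSemigroup (semigroupOfSporadic f A) := by
  refine ⟨.inl rfl, ?_, (Set.finite_Iic f).subset fun x hx => ?_⟩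
  · have large : ∀ x ∈ semigroupOfSporadic f A, x = 0 ∨ f / 2 < x := by
      rintro x (h | h | h)
      · exact .inl h
      · exact .inr (Finset.mem_Ioo.1 (hA h)).1
      · right; omega
    intro a ha b hb
    rcases large a ha with rfl | ha'
    · simpa using hb
    rcases large b hb with rfl | hb'
    · simpa using ha
    exact .inr (.inr (by omega))
  · by_contra h
    exact hx (.inr (.inr (not_le.1 h)))

theorem isFrobenius_semigroupOfSporadic {f : ℕ} (hf : 0 < f) {A : Finset ℕ}
    (hA : A ⊆ Finset.Ioo (f / 2) f) :
    IsFrobenius (semigroupOfSporadic f A) f := by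
  refine ⟨?_, fun m hm => ?_⟩
  · rintro (h | h | h)
    · omega
    · have := Finset.mem_Ioo.1 (hA h)
      omega
    · omega
  · by_contra h
    exact hm (.inr (.inr (not_le.1 h)))

theorem exists_eq_semigroupOfSporadic {f : ℕ} {S : Set ℕ} (h0 : 0 ∈ S)
    (hS : IsFrobenius S f) (hlarge : ∀ s ∈ S, 0 < s → s < f → f < 2 * s) :
    ∃ A ⊆ Finset.Ioo (f / 2) f, semigroupOfSporadic f A = S := by
  classical
  refine ⟨(Finset.Ioo (f / 2) f).filter (· ∈ S), Finset.filter_subset _ _, ?_⟩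
  ext x
  simp only [semigroupOfSporadic, Set.mem_ofPred_eq, Finset.mem_filter, Finset.mem_Ioo]
  constructor
  · rintro (rfl | h | h)
    · exact h0
    · exact h.2
    · by_contra hx
      exact absurd (hS.2 x hx) (by omega)
  · intro hx
    have hne : x ≠ f := fun h => hS.1 (h ▸ hx)
    rcases Nat.eq_zero_or_pos x with h | h
    · exact .inl h
    rcases lt_or_gt_of_ne hne with h' | h'
    · have := hlarge x hx h h'
      exact .inr (.inl ⟨⟨by omega, h'⟩, hx⟩)
    · exact .inr (.inr h')

/-- The number of numerical semigroups with Frobenius number `f` having exactly `n`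
positive sporadic elements, all strictly greater than `f/2`, is
`C(f - ⌊f/2⌋ - 1, n)`. -/
theorem count_elementary_semigroups (n f : ℕ) (hn : 0 < n) (hf : 0 < f) :
    {S : Set ℕ | IsNumericalSemigroup S ∧ IsFrobenius S f ∧
        {s ∈ S | 0 < s ∧ s < f}.ncard = n ∧
        (∀ s ∈ S, 0 < s → s < f → f < 2 * s)}.ncard
      = (f - f / 2 - 1).choose n := by
  have himage : {S : Set ℕ | IsNumericalSemigroup S ∧ IsFrobenius S f ∧
      {s ∈ S | 0 < s ∧ s < f}.ncard = n ∧ (∀ s ∈ S, 0 < s → s < f → f < 2 * s)} =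
      semigroupOfSporadic f '' ((Finset.Ioo (f / 2) f).powersetCard n : Set (Finset ℕ)) := by
    ext S
    simp only [Set.mem_ofPred_eq, Set.mem_image, Finset.mem_coe, Finset.mem_powersetCard]
    constructor
    · rintro ⟨hS, hF, hcard, hlarge⟩
      obtain ⟨A, hA, rfl⟩ := exists_eq_semigroupOfSporadic hS.1 hF hlarge
      rw [sporadic_semigroupOfSporadic hA, Set.ncard_coe_finset] at hcard
      exact ⟨A, ⟨hA, hcard⟩, rfl⟩
    · rintro ⟨A, ⟨hA, hcard⟩, rfl⟩
      refine ⟨isNumericalSemigroup_semigroupOfSporadic hA,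
        isFrobenius_semigroupOfSporadic hf hA, ?_, fun s hs h1 h2 => ?_⟩
      · rw [sporadic_semigroupOfSporadic hA, Set.ncard_coe_finset, hcard]
      · have hsA : s ∈ (A : Set ℕ) := sporadic_semigroupOfSporadic hA ▸ ⟨hs, h1, h2⟩
        have := Finset.mem_Ioo.1 (hA hsA)
        omega
  have hinj : Set.InjOn (semigroupOfSporadic f)
      ((Finset.Ioo (f / 2) f).powersetCard n : Set (Finset ℕ)) := by
    intro A hA B hB h
    rw [Finset.mem_coe, Finset.mem_powersetCard] at hA hB
    rw [← Finset.coe_inj, ← sporadic_semigroupOfSporadic hA.1, h,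
      sporadic_semigroupOfSporadic hB.1]
  rw [himage, hinj.ncard_image, Set.ncard_coe_finset,
    Finset.card_powersetCard, Nat.card_Ioo]
end

section
/- Let τ be a truncated addition table over 3 elements. The SR-polytope P_τ is nonempty if and only if τ is one of the following four symmetric tables: (1) τ(i,j) = ∞ for all i,j; (2) τ(1,1) = 2 and τ(i,j) = ∞ otherwise; (3) τ(1,1) = 3 and τ(i,j) = ∞ otherwise; (4) τ(1,1) = 2, τ(1,2) = τ(2,1) = 3, and τ(i,j) = ∞ otherwise. -/
/-- In a point of the SR-polytope, a finite entry of the table exceeds both of its arguments. -/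
lemma SRPolytope.lt_of_eq_some {n : ℕ} {τ : Fin n → Fin n → Option (Fin n)} {x : Fin n → ℝ}
    (hx : x ∈ SRPolytope n τ) {i j k : Fin n} (h : τ i j = some k) : i < k ∧ j < k := by
  obtain ⟨hb, hm, hs, -⟩ := hx
  have hmono : StrictMono x := fun _ _ hab => hm _ _ hab
  have := hs i j k h
  constructor <;> rw [← hmono.lt_iff_lt]
  · linarith [(hb j).1]
  · linarith [(hb i).1]

/-- The truncated addition table of a nonempty SR-polytope is symmetric. -/
lemma SRPolytope.table_comm {n : ℕ} {τ : Fin n → Fin n → Option (Fin n)} {x : Fin n → ℝ}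
    (hx : x ∈ SRPolytope n τ) (i j : Fin n) : τ i j = τ j i := by
  obtain ⟨hb, hm, hs, hn⟩ := hx
  have hinj : Function.Injective x :=
    StrictMono.injective fun _ _ hab => hm _ _ hab
  rcases hij : τ i j with _ | k <;> rcases hji : τ j i with _ | l
  · rfl
  · linarith [hn i j hij, hs j i l hji, (hb l).2]
  · linarith [hn j i hji, hs i j k hij, (hb k).2]
  · rw [hinj (show x k = x l by linarith [hs i j k hij, hs j i l hji])]

/-- For `n = 3`, the SR-polytope is nonempty exactly for the four addition tables:
the all-∞ table; τ(1,1) = 2; τ(1,1) = 3; and τ(1,1) = 2, τ(1,2) = τ(2,1) = 3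
(indices shifted down by one for `Fin 3`). -/
theorem sr_polytope_three_elements_nonempty_iff (τ : Fin 3 → Fin 3 → Option (Fin 3)) :
    (SRPolytope 3 τ).Nonempty ↔
      (τ = fun _ _ => none) ∨
      (τ = fun i j => if i = 0 ∧ j = 0 then some 1 else none) ∨
      (τ = fun i j => if i = 0 ∧ j = 0 then some 2 else none) ∨
      (τ = fun i j =>
        if i = 0 ∧ j = 0 then some 1
        else if (i = 0 ∧ j = 1) ∨ (i = 1 ∧ j = 0) then some 2
        else none) := by
  constructor
  · rintro ⟨x, hx⟩
    have hlt {i j k : Fin 3} (h : τ i j = some k) : i < k ∧ j < k := SRPolytope.lt_of_eq_some hx h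
    have hcomm := SRPolytope.table_comm hx
    obtain ⟨hb, hm, hs, hn⟩ := hx
    have h01 := hm 0 1 (by decide)
    have h12 := hm 1 2 (by decide)
    have hright (i : Fin 3) : τ i 2 = none := by
      rcases h : τ i 2 with _ | k
      · rfl
      · have := (hlt h).2
        omega
    have hleft (i : Fin 3) : τ 2 i = none := by rw [hcomm, hright]
    have entry_one {i : Fin 3} {k : Fin 3} (h : τ i 1 = some k) : k = 2 := by
      have := (hlt h).2
      omega
    have hmid : τ 1 1 = none := by
      rcases h : τ 1 1 with _ | k
      · rfl
      · obtain rfl := entry_one h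
        have h22 := hs 1 1 2 h
        rcases h' : τ 0 1 with _ | l
        · linarith [hn 0 1 h', (hb 2).2]
        · obtain rfl := entry_one h'
          linarith [hs 0 1 2 h']
    rcases h : τ 0 1 with _ | k
    · have h' : τ 1 0 = none := by rw [hcomm, h]
      rcases h0 : τ 0 0 with _ | l
      · left
        ext1 i; ext1 j
        fin_cases i <;> fin_cases j <;> simp [*]
      · have hl := (hlt h0).1
        obtain rfl | rfl : l = 1 ∨ l = 2 := by omega
        · right; left
          ext1 i; ext1 j
          fin_cases i <;> fin_cases j <;> simp [*]
        · right; right; left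
          ext1 i; ext1 j
          fin_cases i <;> fin_cases j <;> simp [*]
    · obtain rfl := entry_one h
      have h' : τ 1 0 = some 2 := by rw [hcomm, h]
      have h012 := hs 0 1 2 h
      have h0 : τ 0 0 = some 1 := by
        rcases h0 : τ 0 0 with _ | l
        · linarith [hn 0 0 h0, (hb 2).2]
        · have hl := (hlt h0).1
          obtain rfl | rfl : l = 1 ∨ l = 2 := by omega
          · rfl
          · linarith [hs 0 0 2 h0]
      right; right; right
      ext1 i; ext1 j
      fin_cases i <;> fin_cases j <;> simp [*]
  · rintro (rfl | rfl | rfl | rfl)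
    · refine ⟨![0.6, 0.7, 0.8],
        fun i => ?_, fun i j => ?_, fun i j k => ?_, fun i j => ?_⟩
      · fin_cases i <;> norm_num
      · fin_cases i <;> fin_cases j <;> norm_num
      · fin_cases i <;> fin_cases j <;> fin_cases k <;> norm_num <;> decide
      · fin_cases i <;> fin_cases j <;> norm_num
    · refine ⟨![0.4, 0.8, 0.9],
        fun i => ?_, fun i j => ?_, fun i j k => ?_, fun i j => ?_⟩
      · fin_cases i <;> norm_num
      · fin_cases i <;> fin_cases j <;> norm_num
      · fin_cases i <;> fin_cases j <;> fin_cases k <;> norm_num <;> decide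
      · fin_cases i <;> fin_cases j <;> norm_num <;> decide
    · refine ⟨![0.4, 0.7, 0.8],
        fun i => ?_, fun i j => ?_, fun i j k => ?_, fun i j => ?_⟩
      · fin_cases i <;> norm_num
      · fin_cases i <;> fin_cases j <;> norm_num
      · fin_cases i <;> fin_cases j <;> fin_cases k <;> norm_num <;> decide
      · fin_cases i <;> fin_cases j <;> norm_num <;> decide
    · refine ⟨![0.3, 0.6, 0.9],
        fun i => ?_, fun i j => ?_, fun i j k => ?_, fun i j => ?_⟩
      · fin_cases i <;> norm_num
      · fin_cases i <;> fin_cases j <;> norm_num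
      · fin_cases i <;> fin_cases j <;> fin_cases k <;> norm_num <;> decide
      · fin_cases i <;> fin_cases j <;> norm_num <;> decide
end

section
/- Let C ⊆ ℝ^d be a pointed rational polyhedral cone, let P ⊆ ℝ^d be a C-compatible polytope, let α be a positive integer, and let S ⊆ C ∩ ℤ^d be a subset containing 0 and closed under addition. Then S ∪ ((C \ αP) ∩ ℤ^d) contains 0, is closed under addition, and has finite complement in C ∩ ℤ^d; in particular it is a C-semigroup. -/
open Pointwise

/-- The real vector in ℝ^d corresponding to an integer lattice point. -/
def intVec {d : ℕ} (x : Fin d → ℤ) : Fin d → ℝ := fun i => (x i : ℝ)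

/-- A rational polyhedral cone: the set of nonnegative real linear combinations of
finitely many integer vectors. -/
def IsRationalPolyhedralCone {d : ℕ} (C : Set (Fin d → ℝ)) : Prop :=
  ∃ (k : ℕ) (v : Fin k → Fin d → ℝ), (∀ i j, ∃ z : ℤ, v i j = (z : ℝ)) ∧
    C = {x | ∃ c : Fin k → ℝ, (∀ i, 0 ≤ c i) ∧ x = ∑ i, c i • v i}

/-- A cone is pointed if `C ∩ (−C) = {0}`. -/
def IsPointed {d : ℕ} (C : Set (Fin d → ℝ)) : Prop := C ∩ (-C) = {0}

/-- A rational polytope: the convex hull of finitely many rational points. -/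
def IsRationalPolytope {d : ℕ} (P : Set (Fin d → ℝ)) : Prop :=
  ∃ (k : ℕ) (v : Fin k → Fin d → ℝ), (∀ i j, ∃ q : ℚ, v i j = (q : ℝ)) ∧
    P = convexHull ℝ (Set.range v)

/-- `P` contains a neighborhood of the origin in `C`. -/
def ContainsConeNbhdOfZero {d : ℕ} (C P : Set (Fin d → ℝ)) : Prop :=
  ∃ ε : ℝ, 0 < ε ∧ ∀ x ∈ C, (∀ i, |x i| < ε) → x ∈ P

/-- `P` is a `C`-compatible polytope: a rational polytope containing a neighborhood of
the origin in `C` such that for every `x ∈ C \ P`, `x + C ⊆ C \ P`. -/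
def IsCCompatible {d : ℕ} (C P : Set (Fin d → ℝ)) : Prop :=
  IsRationalPolytope P ∧ ContainsConeNbhdOfZero C P ∧
    ∀ x ∈ C \ P, ∀ y ∈ C, x + y ∈ C \ P

theorem IsRationalPolyhedralCone.smul_mem {d : ℕ} {C : Set (Fin d → ℝ)}
    (hC : IsRationalPolyhedralCone C) {t : ℝ} (ht : 0 ≤ t) {x : Fin d → ℝ} (hx : x ∈ C) :
    t • x ∈ C := by
  obtain ⟨k, v, -, rfl⟩ := hC
  obtain ⟨c, hc, rfl⟩ := hx
  exact ⟨fun i => t * c i, fun i => mul_nonneg ht (hc i), by simp [Finset.smul_sum, mul_smul]⟩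

theorem IsRationalPolyhedralCone.add_mem {d : ℕ} {C : Set (Fin d → ℝ)}
    (hC : IsRationalPolyhedralCone C) {x y : Fin d → ℝ} (hx : x ∈ C) (hy : y ∈ C) :
    x + y ∈ C := by
  obtain ⟨k, v, -, rfl⟩ := hC
  obtain ⟨b, hb, rfl⟩ := hx
  obtain ⟨c, hc, rfl⟩ := hy
  exact ⟨fun i => b i + c i, fun i => add_nonneg (hb i) (hc i),
    by simp [Finset.sum_add_distrib, add_smul]⟩

theorem IsRationalPolytope.isBounded {d : ℕ} {P : Set (Fin d → ℝ)}
    (hP : IsRationalPolytope P) : Bornology.IsBounded P := by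
  obtain ⟨k, v, -, rfl⟩ := hP
  exact isBounded_convexHull.2 (Set.finite_range v).isBounded

theorem intVec_add {d : ℕ} (x y : Fin d → ℤ) : intVec (x + y) = intVec x + intVec y := by
  ext i
  simp [intVec]

/-- A bounded set contains only finitely many lattice points. -/
theorem finite_intVec_preimage {d : ℕ} {B : Set (Fin d → ℝ)} (hB : Bornology.IsBounded B) :
    (intVec ⁻¹' B).Finite := by
  obtain ⟨R, hR⟩ := hB.exists_norm_le
  refine (Set.finite_Icc (fun _ : Fin d => -⌈R⌉) (fun _ => ⌈R⌉)).subset fun x hx => ?_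
  have key (i : Fin d) : |x i| ≤ ⌈R⌉ := by
    have h : |(x i : ℝ)| ≤ R := (norm_le_pi_norm (intVec x) i).trans (hR _ hx)
    exact_mod_cast h.trans (Int.le_ceil R)
  exact ⟨fun i => (abs_le.1 (key i)).1, fun i => (abs_le.1 (key i)).2⟩

/-- The translation property of a compatible polytope passes to its positive dilates. -/
theorem IsCCompatible.add_mem_diff_smul {d : ℕ} {C P : Set (Fin d → ℝ)}
    (hC : IsRationalPolyhedralCone C) (hP : IsCCompatible C P) {t : ℝ} (ht : 0 < t)
    {x y : Fin d → ℝ} (hx : x ∈ C \ t • P) (hy : y ∈ C) : x + y ∈ C \ t • P := by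
  have ht' : 0 ≤ t⁻¹ := inv_nonneg.2 ht.le
  have h := hP.2.2 (t⁻¹ • x)
    ⟨hC.smul_mem ht' hx.1, fun h => hx.2 ((Set.mem_smul_set_iff_inv_smul_mem₀ ht.ne' _ _).2 h)⟩
    (t⁻¹ • y) (hC.smul_mem ht' hy)
  rw [← smul_add] at h
  exact ⟨hC.add_mem hx.1 hy,
    fun h' => h.2 ((Set.mem_smul_set_iff_inv_smul_mem₀ ht.ne' _ _).1 h')⟩


/-- Adjoining to a submonoid `S` of `C ∩ ℤ^d` all lattice points of `C` outside the
dilate `αP` of a `C`-compatible polytope again yields a `C`-semigroup: it contains 0, is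
closed under addition, lies in `C`, and has finite complement in `C ∩ ℤ^d`. -/
theorem union_outside_dilate_is_C_semigroup (d : ℕ) (C P : Set (Fin d → ℝ))
    (hC : IsRationalPolyhedralCone C) (hCpt : IsPointed C) (hP : IsCCompatible C P)
    (α : ℕ) (hα : 0 < α) (S : Set (Fin d → ℤ))
    (h0 : 0 ∈ S) (hSC : ∀ x ∈ S, intVec x ∈ C) (hadd : ∀ x ∈ S, ∀ y ∈ S, x + y ∈ S) :
    0 ∈ S ∪ {x : Fin d → ℤ | intVec x ∈ C \ (α : ℝ) • P} ∧
    (∀ x ∈ S ∪ {x : Fin d → ℤ | intVec x ∈ C \ (α : ℝ) • P},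
      ∀ y ∈ S ∪ {x : Fin d → ℤ | intVec x ∈ C \ (α : ℝ) • P},
        x + y ∈ S ∪ {x : Fin d → ℤ | intVec x ∈ C \ (α : ℝ) • P}) ∧
    (∀ x ∈ S ∪ {x : Fin d → ℤ | intVec x ∈ C \ (α : ℝ) • P}, intVec x ∈ C) ∧
    {x : Fin d → ℤ | intVec x ∈ C ∧
      x ∉ S ∪ {x : Fin d → ℤ | intVec x ∈ C \ (α : ℝ) • P}}.Finite := by
  have hα' : (0 : ℝ) < α := Nat.cast_pos.2 hα
  have hC' : ∀ x ∈ S ∪ {x : Fin d → ℤ | intVec x ∈ C \ (α : ℝ) • P}, intVec x ∈ C := by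
    rintro x (hx | hx)
    exacts [hSC x hx, hx.1]
  refine ⟨Or.inl h0, ?_, hC', ?_⟩
  · rintro x (hx | hx) y hy
    · rcases hy with hy | hy
      · exact Or.inl (hadd x hx y hy)
      · refine Or.inr ?_
        rw [Set.mem_ofPred_eq, add_comm, intVec_add]
        exact hP.add_mem_diff_smul hC hα' hy (hSC x hx)
    · refine Or.inr ?_
      rw [Set.mem_ofPred_eq, intVec_add]
      exact hP.add_mem_diff_smul hC hα' hx (hC' y hy)
  · refine (finite_intVec_preimage (hP.1.isBounded.smul₀ (α : ℝ))).subset ?_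
    rintro x ⟨hx, hx'⟩
    by_contra h
    exact hx' (Or.inr ⟨hx, h⟩)
end
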